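/- arXiv:1307.7986 — 6 statements merged into one kernel-verified Lean document; each statement's English description precedes it below -/
import Mathlib

section
/- Let c ∈ 𝒜⁺. Then c is dense if and only if c is a cyclic rotation of one of the following five sequences: (1,1,1), (1,2,1,2), (1,3,1,3,1,3), (1,3,1,4,1,3,1,4), (1,3,1,5,1,3,1,5,1,3,1,5). -/
open Matrix Finset

/-- The matrix `η(a)` with rows `(a, -1)` and `(1, 0)`. -/
def etaM (a : ℤ) : Matrix (Fin 2) (Fin 2) ℤ := !![a, -1; 1, 0]

/-- The set `𝒜⁺` of η-sequences, as an inductive predicate on lists of integers. -/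
inductive IsEta : List ℤ → Prop
  | base : IsEta [0, 0]
  | rotate {c : List ℤ} : IsEta c → IsEta (c.rotate 1)
  | reverse {c : List ℤ} : IsEta c → IsEta c.reverse
  | expand {a b : ℤ} {t : List ℤ} : IsEta (a :: b :: t) → IsEta ((a + 1) :: 1 :: (b + 1) :: t)

/-- The `i`-th entry (1-indexed) of a sequence. -/
def entryOf (c : List ℤ) (i : ℕ) : ℤ := c.getD (i - 1) 0

/-- `φ_i(j)`: `0` if `i = j`; the (2,1)-entry of `η(c_i)⋯η(c_{j-1})` if `i < j`;
the (2,1)-entry of `η(c_j)⋯η(c_{i-1})` if `j < i`.  (Indices are 1-based.) -/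
def phi (c : List ℤ) (i j : ℕ) : ℤ :=
  if i = j then 0
  else if i < j then (((c.drop (i - 1)).take (j - i)).map etaM).prod 1 0
  else (((c.drop (j - 1)).take (i - j)).map etaM).prod 1 0

open Classical in
/-- `m_i`: the set of positions `j ∈ {1,…,n}` where `φ_i` attains its maximum. -/
noncomputable def mset (c : List ℤ) (i : ℕ) : Finset ℕ :=
  (Finset.Icc 1 c.length).filter (fun j => ∀ l ∈ Finset.Icc 1 c.length, phi c i l ≤ phi c i j)

/-- `i ⊕ k`: addition of 1-based indices, wrapping around modulo `n` (for `i + k ≤ 2n`). -/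
def addIdx (n i k : ℕ) : ℕ := if i + k ≤ n then i + k else i + k - n

/-- `c` is dense if for every `i ∈ {1,…,n}`, `|m_i| > 1` or `|m_{i+1}| > 1`
(indices taken cyclically). -/
def DenseSeq (c : List ℤ) : Prop :=
  ∀ i ∈ Finset.Icc 1 c.length,
    1 < (mset c i).card ∨ 1 < (mset c (addIdx c.length i 1)).card

/-- `c` is fan-shaped if a cyclic rotation of `c` equals `(n-2, 1, 2, …, 2, 1)`. -/
def IsFan (c : List ℤ) : Prop :=
  ∃ k, c.rotate k =
    ((c.length : ℤ) - 2) :: 1 :: (List.replicate (c.length - 3) (2 : ℤ) ++ [1])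

/-- The metric data of a frieze: `lam a b` is the frieze entry between the vertices `a` and `b` of
a polygon whose boundary is traversed by the permutation `s`, and `c` is the quiddity cycle. -/
structure FriezeMetric {ι : Type*} (s : Equiv.Perm ι) (c : ι → ℤ) (lam : ι → ι → ℤ) : Prop where
  comm : ∀ a b, lam a b = lam b a
  self : ∀ a, lam a a = 0
  pos : ∀ a b, a ≠ b → 0 < lam a b
  next : ∀ a, lam a (s a) = 1
  ptolemy : ∀ i k l, lam k l = |lam (s i) k * lam i l - lam (s i) l * lam i k|
  sum : ∀ i l, l ≠ i → lam (s.symm i) l + lam (s i) l = c i * lam i l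

/-- `j` is a vertex at maximal distance from `i`. -/
def IsFarthest {ι : Type*} (lam : ι → ι → ℤ) (i j : ι) : Prop := ∀ l, lam i l ≤ lam i j

/-- At least two vertices are at maximal distance from `i`. -/
def HasTwoFarthest {ι : Type*} (lam : ι → ι → ℤ) (i : ι) : Prop :=
  ∃ j k, j ≠ k ∧ IsFarthest lam i j ∧ IsFarthest lam i k

namespace FriezeMetric

variable {ι : Type*} {s : Equiv.Perm ι} {c : ι → ℤ} {lam : ι → ι → ℤ}

theorem reverse (F : FriezeMetric s c lam) : FriezeMetric s.symm c lam where
  comm := F.comm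
  self := F.self
  pos := F.pos
  next a := by
    have := F.next (s.symm a)
    rwa [s.apply_symm_apply, F.comm] at this
  ptolemy i k l := by
    have := F.ptolemy (s.symm i) k l
    rw [s.apply_symm_apply] at this
    rw [this, abs_sub_comm]
    congr 1
    ring
  sum i l h := by
    have := F.sum i l h
    rw [Equiv.symm_symm]
    linarith

theorem nonneg (F : FriezeMetric s c lam) (a b : ι) : 0 ≤ lam a b := by
  by_cases h : a = b
  · subst h; rw [F.self]
  · exact (F.pos a b h).le

theorem eq_of_eq_zero (F : FriezeMetric s c lam) {a b : ι} (h : lam a b = 0) : a = b := by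
  by_contra hab
  have := F.pos a b hab
  omega

theorem ne_of_pos (F : FriezeMetric s c lam) {a b : ι} (h : 0 < lam a b) : a ≠ b := by
  rintro rfl
  rw [F.self] at h
  omega

theorem eq_of_coords (F : FriezeMetric s c lam) {i k l : ι} (h₁ : lam i k = lam i l)
    (h₂ : lam (s i) k = lam (s i) l) : k = l := by
  apply F.eq_of_eq_zero
  rw [F.ptolemy i k l, h₁, h₂]
  simp

theorem coprime (F : FriezeMetric s c lam) (i l : ι) : IsCoprime (lam i l) (lam (s i) l) := by
  have h := F.ptolemy i l (s l)
  rw [F.next] at h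
  rcases abs_choice (lam (s i) l * lam i (s l) - lam (s i) (s l) * lam i l) with h' | h' <;>
    rw [h'] at h
  · exact ⟨-lam (s i) (s l), lam i (s l), by linarith⟩
  · exact ⟨lam (s i) (s l), -lam i (s l), by linarith⟩

theorem next_symm (F : FriezeMetric s c lam) (a : ι) : lam (s a) a = 1 := by
  rw [F.comm, F.next]

theorem quiddity_eq (F : FriezeMetric s c lam) (a : ι) : c (s a) = lam a (s (s a)) := by
  have h := F.sum (s a) a (F.ne_of_pos (by rw [F.next]; norm_num))
  rw [s.symm_apply_apply, F.self, F.next_symm, F.comm] at h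
  linarith

theorem quiddity_nonneg (F : FriezeMetric s c lam) (a : ι) : 0 ≤ c a := by
  have := F.quiddity_eq (s.symm a)
  rw [s.apply_symm_apply] at this
  rw [this]
  exact F.nonneg _ _

theorem quiddity_eq_one (F : FriezeMetric s c lam) {i j : ι} (hj : IsFarthest lam i j)
    (h2 : 2 ≤ lam i j) : c j = 1 := by
  have hij : i ≠ j := F.ne_of_pos (by omega)
  have h := F.sum j i hij
  have h₁ := hj (s.symm j)
  have h₂ := hj (s j)
  have hc := F.coprime j i
  rw [F.comm i] at h₁ h₂ h2
  rw [F.comm i j] at h₁ h₂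
  have hc0 := F.quiddity_nonneg j
  have hn₁ := F.nonneg (s.symm j) i
  have hn₂ := F.nonneg (s j) i
  have hle : c j ≤ 2 := by
    by_contra! hlt
    nlinarith
  have hcases : c j = 0 ∨ c j = 1 ∨ c j = 2 := by omega
  rcases hcases with h0 | h1 | h2'
  · rw [h0] at h
    have : s j = i := F.eq_of_eq_zero (by omega)
    rw [← this, F.next] at h2
    omega
  · exact h1
  · rw [h2'] at h
    have : lam (s j) i = lam j i := by omega
    rw [this, isCoprime_self, Int.isUnit_iff] at hc
    omega

theorem ear_sum (F : FriezeMetric s c lam) {j l : ι} (hj : c j = 1) (hl : l ≠ j) :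
    lam (s.symm j) l + lam (s j) l = lam j l := by
  rw [F.sum j l hl, hj, one_mul]

/-- If `e` and `l` are ears and `s e` is joined to `l` then `l` is two steps after `e`. -/
theorem ear_step (F : FriezeMetric s c lam) {e l : ι} (hl : c l = 1) (hel : e ≠ l)
    (h : lam l (s e) = 1) : s (s e) = l := by
  have hne : s e ≠ l := (F.ne_of_pos (by omega)).symm
  have hsum := F.ear_sum hl hne
  have h₁ := F.nonneg (s.symm l) (s e)
  have h₂ := F.nonneg (s l) (s e)
  have : lam (s l) (s e) ≠ 0 := fun h0 => hel (s.injective (F.eq_of_eq_zero h0)).symm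
  have : s.symm l = s e := F.eq_of_eq_zero (by omega)
  rw [← this, s.apply_symm_apply]

/-- The distances to the vertex after the ear `s (s e)`. -/
theorem lam_next_ear (F : FriezeMetric s c lam) {e l m : ι} (hl : c l = 1) (h : s (s e) = l)
    (hm : m ≠ l) : lam m (s l) = lam m l - lam m (s e) := by
  have := F.ear_sum hl hm
  rw [← h, s.symm_apply_apply, h] at this
  rw [F.comm m, F.comm m, F.comm m (s e)]
  linarith

end FriezeMetric

/-- A triangle: one ear at each vertex. -/
def IsTri {ι : Type*} (s : Equiv.Perm ι) (c : ι → ℤ) : Prop :=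
  ∃ a, s a ≠ a ∧ s (s (s a)) = a ∧ c a = 1 ∧ c (s a) = 1 ∧ c (s (s a)) = 1

/-- Two opposite ears. -/
def IsQuad {ι : Type*} (s : Equiv.Perm ι) (c : ι → ℤ) : Prop :=
  ∃ a b, a ≠ b ∧ s (s a) = b ∧ s (s b) = a ∧ c a = 1 ∧ c b = 1 ∧ c (s a) = 2 ∧ c (s b) = 2

/-- A triangle with an ear attached to each of its sides. -/
def IsHexa {ι : Type*} (s : Equiv.Perm ι) (c : ι → ℤ) : Prop :=
  ∃ a b d, a ≠ b ∧ s (s a) = b ∧ s (s b) = d ∧ s (s d) = a ∧ c a = 1 ∧ c b = 1 ∧ c d = 1 ∧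
    c (s a) = 3 ∧ c (s b) = 3 ∧ c (s d) = 3

/-- A quadrangle with an ear attached to each of its sides. -/
def IsOcta {ι : Type*} (s : Equiv.Perm ι) (c : ι → ℤ) : Prop :=
  ∃ a₀ a₁ a₂ a₃, a₀ ≠ a₂ ∧ s (s a₀) = a₁ ∧ s (s a₁) = a₂ ∧ s (s a₂) = a₃ ∧ s (s a₃) = a₀ ∧
    c a₀ = 1 ∧ c a₁ = 1 ∧ c a₂ = 1 ∧ c a₃ = 1 ∧
    c (s a₀) = 3 ∧ c (s a₁) = 4 ∧ c (s a₂) = 3 ∧ c (s a₃) = 4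

/-- A hexagon with an inner triangle, with an ear attached to each of its sides. -/
def IsDodeca {ι : Type*} (s : Equiv.Perm ι) (c : ι → ℤ) : Prop :=
  ∃ a₀ a₁ a₂ a₃ a₄ a₅, a₀ ≠ a₂ ∧ a₀ ≠ a₃ ∧ s (s a₀) = a₁ ∧ s (s a₁) = a₂ ∧ s (s a₂) = a₃ ∧
    s (s a₃) = a₄ ∧ s (s a₄) = a₅ ∧ s (s a₅) = a₀ ∧
    c a₀ = 1 ∧ c a₁ = 1 ∧ c a₂ = 1 ∧ c a₃ = 1 ∧ c a₄ = 1 ∧ c a₅ = 1 ∧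
    c (s a₀) = 3 ∧ c (s a₁) = 5 ∧ c (s a₂) = 3 ∧ c (s a₃) = 5 ∧ c (s a₄) = 3 ∧ c (s a₅) = 5

theorem Equiv.Perm.two_step_of_symm {ι : Type*} {s : Equiv.Perm ι} {a b : ι}
    (h : s.symm (s.symm a) = b) : s (s b) = a ∧ s b = s.symm a := by
  subst h
  simp

theorem IsOcta.of_symm {ι : Type*} {s : Equiv.Perm ι} {c : ι → ℤ} (h : IsOcta s.symm c) :
    IsOcta s c := by
  obtain ⟨a₀, a₁, a₂, a₃, hne, h₀, h₁, h₂, h₃, c₀, c₁, c₂, c₃, d₀, d₁, d₂, d₃⟩ := h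
  obtain ⟨g₀, e₀⟩ := Equiv.Perm.two_step_of_symm h₀
  obtain ⟨g₁, e₁⟩ := Equiv.Perm.two_step_of_symm h₁
  obtain ⟨g₂, e₂⟩ := Equiv.Perm.two_step_of_symm h₂
  obtain ⟨g₃, e₃⟩ := Equiv.Perm.two_step_of_symm h₃
  rw [← e₀] at d₀
  rw [← e₁] at d₁
  rw [← e₂] at d₂
  rw [← e₃] at d₃
  refine ⟨a₁, a₀, a₃, a₂, ?_, g₀, g₃, g₂, g₁, c₁, c₀, c₃, c₂, d₀, d₃, d₂, d₁⟩
  intro h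
  exact hne (by rw [← g₀, ← g₂, h])

theorem IsDodeca.of_symm {ι : Type*} {s : Equiv.Perm ι} {c : ι → ℤ} (h : IsDodeca s.symm c) :
    IsDodeca s c := by
  obtain ⟨a₀, a₁, a₂, a₃, a₄, a₅, hne, hne', h₀, h₁, h₂, h₃, h₄, h₅, c₀, c₁, c₂, c₃, c₄, c₅,
    d₀, d₁, d₂, d₃, d₄, d₅⟩ := h
  obtain ⟨g₀, e₀⟩ := Equiv.Perm.two_step_of_symm h₀
  obtain ⟨g₁, e₁⟩ := Equiv.Perm.two_step_of_symm h₁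
  obtain ⟨g₂, e₂⟩ := Equiv.Perm.two_step_of_symm h₂
  obtain ⟨g₃, e₃⟩ := Equiv.Perm.two_step_of_symm h₃
  obtain ⟨g₄, e₄⟩ := Equiv.Perm.two_step_of_symm h₄
  obtain ⟨g₅, e₅⟩ := Equiv.Perm.two_step_of_symm h₅
  rw [← e₀] at d₀
  rw [← e₁] at d₁
  rw [← e₂] at d₂
  rw [← e₃] at d₃
  rw [← e₄] at d₄
  rw [← e₅] at d₅
  refine ⟨a₁, a₀, a₅, a₄, a₃, a₂, ?_, ?_, g₀, g₅, g₄, g₃, g₂, g₁, c₁, c₀, c₅, c₄, c₃, c₂,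
    d₀, d₅, d₄, d₃, d₂, d₁⟩
  · intro h
    have h04 : a₀ = a₄ := by rw [← g₀, ← g₄, h]
    have h53 : a₅ = a₃ := by rw [← g₅, ← g₃, h04]
    have h42 : a₄ = a₂ := by rw [← g₄, ← g₂, h53]
    exact hne (h04.trans h42)
  · intro h
    exact hne' (by rw [← g₀, ← g₃, h])

namespace FriezeMetric

variable {ι : Type*} {s : Equiv.Perm ι} {c : ι → ℤ} {lam : ι → ι → ℤ}

/-- If every distance is at most one, there are at most three vertices. -/
theorem isTri_of_le_one (F : FriezeMetric s c lam) (hD : ∀ a b, lam a b ≤ 1) {i : ι}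
    (h : HasTwoFarthest lam i) : IsTri s c := by
  have hone : ∀ {a b}, a ≠ b → lam a b = 1 := fun hab => le_antisymm (hD _ _) (F.pos _ _ hab)
  have hne : ∀ a, s a ≠ a := fun a => (F.ne_of_pos (by rw [F.next]; norm_num)).symm
  have hne' : ∀ a, s.symm a ≠ a := fun a h => hne a (by rw [← h, s.apply_symm_apply, h])
  have hc : ∀ a, c a ≤ 1 := fun a => by
    have := F.quiddity_eq (s.symm a)
    rw [s.apply_symm_apply] at this
    rw [this]
    exact hD _ _
  have key : ∀ l, l = i ∨ l = s.symm i ∨ l = s i := by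
    intro l
    by_contra! hl
    have h₁ := F.sum i l hl.1
    rw [hone hl.2.1.symm, hone hl.2.2.symm, hone hl.1.symm] at h₁
    have := hc i
    omega
  have hps : s.symm i ≠ s i := by
    intro hps
    obtain ⟨j, k, hjk, hj, hk⟩ := h
    have h₁ : ∀ m, IsFarthest lam i m → m ≠ i := by
      rintro m hm rfl
      have := hm (s m)
      rw [F.next, F.self] at this
      omega
    have := h₁ j hj
    have := h₁ k hk
    have := key j
    have := key k
    rw [hps] at *
    grind
  have hss : s (s i) = s.symm i := by
    rcases key (s (s i)) with h | h | h
    · exact absurd (s.symm_apply_eq.2 h.symm) hps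
    · exact h
    · exact absurd h (hne _)
  have hc' : ∀ a, s (s a) ≠ a → c (s a) = 1 := fun a ha => by
    rw [F.quiddity_eq a, hone ha.symm]
  have hsss : s (s (s i)) = i := by rw [hss, s.apply_symm_apply]
  refine ⟨i, hne i, hsss, ?_, hc' _ ?_, hc' _ ?_⟩
  · have := hc' (s (s i)) (by rw [hsss]; intro h; exact hps (by rw [← hss, ← h]))
    rwa [hsss] at this
  · rw [hss]; exact hne' i
  · rw [hsss]; exact (hne i).symm

/-- Two vertices at the global maximal distance `D` from `i`: one of them is two steps after `i`. -/
theorem two_step_aux (F : FriezeMetric s c lam) {D : ℤ} (hmax : ∀ a b, lam a b ≤ D) (h2 : 2 ≤ D)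
    (hd : ∀ a, HasTwoFarthest lam a ∨ HasTwoFarthest lam (s a)) {i j j' : ι}
    (hj : lam i j = D) (hj' : lam i j' = D) (hx : lam (s i) j' = lam (s i) j + 1) :
    s (s i) = j := by
  set x := lam (s i) j with hxdef
  have hsj : s i ≠ j := by
    rintro rfl
    rw [F.next] at hj
    omega
  have hx0 : 0 < x := F.pos _ _ hsj
  have hcop := F.coprime i j'
  rw [hj', hx] at hcop
  have hxD : x + 1 < D := by
    have h₁ := hmax (s i) j'
    rw [hx] at h₁
    rcases h₁.lt_or_eq with h | h
    · exact h
    · rw [h, isCoprime_self, Int.isUnit_iff] at hcop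
      omega
  have far : ∀ l, x + 1 ≤ lam (s i) l → lam i l = D ∧ lam (s i) l = x + 1 := by
    intro l hl
    have h₁ := F.ptolemy i j l
    have h₂ := hmax j l
    rw [h₁, hj, ← hxdef, abs_sub_comm] at h₂
    have h₃ := (le_abs_self _).trans h₂
    have h₄ := hmax i l
    have hle : lam (s i) l ≤ x + 1 := by
      by_contra! hlt
      nlinarith [mul_le_mul_of_nonneg_left h₄ hx0.le]
    have heq : lam (s i) l = x + 1 := le_antisymm hle hl
    refine ⟨le_antisymm h₄ ?_, heq⟩
    rw [heq] at h₃
    by_contra! hlt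
    nlinarith
  have hnot : ¬ HasTwoFarthest lam (s i) := by
    rintro ⟨k, k', hne, hk, hk'⟩
    have h₁ := far k (hx ▸ hk j')
    have h₂ := far k' (hx ▸ hk' j')
    exact hne (F.eq_of_coords (h₁.1.trans h₂.1.symm) (h₁.2.trans h₂.2.symm))
  obtain ⟨k, hkj, hk⟩ : ∃ k, k ≠ j' ∧ IsFarthest lam (s (s i)) k := by
    obtain ⟨k, k', hne, hk, hk'⟩ := (hd (s i)).resolve_left hnot
    by_cases h : k = j'
    · exact ⟨k', fun h' => hne (h.trans h'.symm), hk'⟩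
    · exact ⟨k, h, hk⟩
  have hsum : ∀ l, l ≠ s i → lam i l + lam (s (s i)) l = c (s i) * lam (s i) l := by
    intro l hl
    have := F.sum (s i) l hl
    rwa [s.symm_apply_apply] at this
  have hsj' : s i ≠ j' := by
    rintro rfl
    rw [F.next] at hj'
    omega
  have s₁ := hsum j hsj.symm
  have s₂ := hsum j' hsj'.symm
  rw [hj, ← hxdef] at s₁
  rw [hj', hx] at s₂
  have n₁ := F.nonneg (s (s i)) j
  have kj' := hk j'
  have kj := hk j
  have hks : k ≠ s i := by
    rintro rfl
    rw [F.next_symm] at kj kj'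
    have hc1 : c (s i) ≤ 1 := by linarith
    nlinarith
  have s₃ := hsum k hks
  set X := lam (s i) k with hX
  set Y := lam i k with hY
  have hXx : X ≤ x := by
    by_contra! hlt
    have := far k hlt
    exact hkj (F.eq_of_coords (this.1.trans hj'.symm) (this.2.trans hx.symm))
  have hjk := (le_abs_self _).trans ((F.ptolemy i k j).symm.le.trans (hmax k j))
  rw [hj, ← hX, ← hY, ← hxdef] at hjk
  have ht : c (s i) * (x + 1 - X) ≤ D - Y := by linarith
  have hcx : c (s i) * x ≤ D := by
    by_contra! hlt
    nlinarith [mul_le_mul_of_nonneg_left ht hx0.le, mul_pos (show 0 < x + 1 - X by omega)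
      (show 0 < c (s i) * x - D by omega)]
  exact F.eq_of_eq_zero (by omega)

theorem two_step (F : FriezeMetric s c lam) {D : ℤ} (hmax : ∀ a b, lam a b ≤ D) (h2 : 2 ≤ D)
    (hd : ∀ a, HasTwoFarthest lam a ∨ HasTwoFarthest lam (s a)) {i j j' : ι} (hne : j ≠ j')
    (hj : lam i j = D) (hj' : lam i j' = D) :
    lam j j' = D ∧ (s (s i) = j ∨ s (s i) = j') := by
  have h := F.ptolemy i j j'
  rw [hj, hj', ← sub_mul, abs_mul, abs_of_pos (show 0 < D by omega)] at h
  have hpos := F.pos _ _ hne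
  have hle := hmax j j'
  have habs : |lam (s i) j - lam (s i) j'| = 1 := by
    have h₁ : |lam (s i) j - lam (s i) j'| ≤ 1 := by
      by_contra! hlt
      nlinarith
    have h₂ : 0 < |lam (s i) j - lam (s i) j'| := by
      by_contra! hlt
      nlinarith
    omega
  refine ⟨by rw [h, habs, one_mul], ?_⟩
  rcases abs_choice (lam (s i) j - lam (s i) j') with h' | h' <;> rw [h'] at habs
  · exact Or.inr (F.two_step_aux hmax h2 hd hj' hj (by omega))
  · exact Or.inl (F.two_step_aux hmax h2 hd hj hj' (by omega))

theorem isHexa_of_cycle (F : FriezeMetric s c lam) {D : ℤ} (hmax : ∀ a b, lam a b ≤ D)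
    (h2 : 2 ≤ D) {a b d : ι} (hab : lam a b = D) (hbd : lam b d = D) (hda : lam d a = D)
    (h₁ : s (s a) = b) (h₂ : s (s b) = d) (h₃ : s (s d) = a) : IsHexa s c := by
  have ear : ∀ {u v}, lam u v = D → c v = 1 := fun {u v} h =>
    F.quiddity_eq_one (i := u) (fun l => h ▸ hmax u l) (by omega)
  have ca := ear hda
  have cb := ear hab
  have cd := ear hbd
  have qa := F.quiddity_eq a
  have qb := F.quiddity_eq b
  have qd := F.quiddity_eq d
  rw [h₁, hab] at qa
  rw [h₂, hbd] at qb
  rw [h₃, hda] at qd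
  have ne : ∀ {u v}, lam u v = D → s u ≠ v := fun {u v} h h' => by
    rw [← h', F.next] at h
    omega
  have hba : lam b a = D := by rw [F.comm, hab]
  have hne : a ≠ b := F.ne_of_pos (by omega)
  have e₁ := F.ear_sum cb (ne hab)
  have e₂ := F.ear_sum cd (l := s a) (by rw [F.comm] at hda; exact ne hda)
  have e₃ := F.sum (s b) (s a) (fun h => hne (s.injective h))
  rw [← h₁, s.symm_apply_apply, F.self, h₁, F.comm b, ← h₁, F.next, h₁] at e₁
  rw [← h₂, s.symm_apply_apply, h₂, ← s.symm_apply_eq.2 h₃.symm] at e₂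
  rw [s.symm_apply_apply, h₂, qb, F.comm b, ← h₁, F.next, h₁] at e₃
  have e₄ := F.quiddity_eq (s.symm a)
  rw [s.apply_symm_apply, ca] at e₄
  rw [← e₄] at e₂
  have hD : D = 3 := by nlinarith
  subst hD
  exact ⟨a, b, d, hne, h₁, h₂, h₃, ca, cb, cd, qa, qb, qd⟩

theorem isHexa_of_two (F : FriezeMetric s c lam) {D : ℤ} (hmax : ∀ a b, lam a b ≤ D)
    (h2 : 2 ≤ D) (hd : ∀ a, HasTwoFarthest lam a ∨ HasTwoFarthest lam (s a)) {i j j' : ι}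
    (hne : j ≠ j') (hj : lam i j = D) (hj' : lam i j' = D) : IsHexa s c := by
  obtain ⟨hjj, hi⟩ := F.two_step hmax h2 hd hne hj hj'
  have hji : lam j i = D := by rw [F.comm, hj]
  have hji' : lam j' i = D := by rw [F.comm, hj']
  have hjj' : lam j' j = D := by rw [F.comm, hjj]
  have nj : i ≠ j := F.ne_of_pos (by omega)
  have nj' : i ≠ j' := F.ne_of_pos (by omega)
  obtain ⟨-, h₁⟩ := F.two_step hmax h2 hd nj' hji hjj
  obtain ⟨-, h₂⟩ := F.two_step hmax h2 hd nj hji' hjj'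
  have inj : ∀ {a b}, s (s a) = s (s b) → a = b := fun h => s.injective (s.injective h)
  rcases hi with hi | hi
  · have h₂' : s (s j') = i := h₂.resolve_right fun h => nj' (inj (hi.trans h.symm))
    have h₁' : s (s j) = j' := h₁.resolve_left fun h => hne (inj (h.trans h₂'.symm))
    exact F.isHexa_of_cycle hmax h2 hj hjj hji' hi h₁' h₂'
  · have h₁' : s (s j) = i := h₁.resolve_right fun h => nj (inj (hi.trans h.symm))
    have h₂' : s (s j') = j := h₂.resolve_left fun h => hne (inj (h₁'.trans h.symm))
    exact F.isHexa_of_cycle hmax h2 hj' hjj' hji hi h₂' h₁'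

end FriezeMetric

theorem Int.emod_two_eq_one_of_isCoprime_two {a : ℤ} (h : IsCoprime a 2) : a % 2 = 1 := by
  obtain ⟨u, v, huv⟩ := h
  by_contra hne
  obtain ⟨m, rfl⟩ : (2 : ℤ) ∣ a := by omega
  have : 2 * (u * m + v) = 1 := by linarith
  omega

namespace FriezeMetric

variable {ι : Type*} {s : Equiv.Perm ι} {c : ι → ℤ} {lam : ι → ι → ℤ}

/-- If `j` is the only vertex at the global maximal distance `D` from `i`, then it is farthest from
`s i` as well. -/
theorem farthest_next (F : FriezeMetric s c lam) {D : ℤ} (hmax : ∀ a b, lam a b ≤ D)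
    (h2 : 2 ≤ D) {i j : ι} (hj : lam i j = D) (huniq : ∀ l, lam i l = D → l = j) :
    IsFarthest lam (s i) j := by
  intro l
  have hsj : s i ≠ j := by
    rintro rfl
    rw [F.next] at hj
    omega
  have hp := F.pos _ _ hsj
  by_contra! hlt
  have h₁ := (le_abs_self _).trans ((F.ptolemy i l j).symm.le.trans (hmax l j))
  rw [hj] at h₁
  have h₂ := hmax i l
  have h₃ : lam i l = D := by
    refine le_antisymm h₂ ?_
    by_contra! hlt'
    nlinarith
  rw [huniq l h₃] at hlt
  omega

theorem exists_ne_farthest_next (F : FriezeMetric s c lam) {D : ℤ} (hmax : ∀ a b, lam a b ≤ D)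
    (h2 : 2 ≤ D) {i j : ι} (hj : lam i j = D) (huniq : ∀ l, lam i l = D → l = j)
    (htwo : HasTwoFarthest lam (s i)) :
    ∃ k, IsFarthest lam (s i) k ∧ lam (s i) k = lam (s i) j ∧ lam i k < D := by
  have hfar := F.farthest_next hmax h2 hj huniq
  obtain ⟨k, hkj, hk⟩ : ∃ k, k ≠ j ∧ IsFarthest lam (s i) k := by
    obtain ⟨k, k', hne, hk, hk'⟩ := htwo
    by_cases h : k = j
    · exact ⟨k', fun h' => hne (h.trans h'.symm), hk'⟩
    · exact ⟨k, h, hk⟩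
  exact ⟨k, hk, le_antisymm (hfar k) (hk j),
    lt_of_le_of_ne (hmax _ _) fun h => hkj (huniq k h)⟩

/-- Two ears determined by a pair `i`, `j` of vertices at the global maximal distance, in the
coordinates given by `s i` and `i`. -/
theorem exists_ears (F : FriezeMetric s c lam) {D p q : ℤ} (hmax : ∀ a b, lam a b ≤ D)
    (h2 : 2 ≤ D) {i j : ι} (hj : lam i j = D) (huniq : ∀ l, lam i l = D → l = j)
    (htwo : HasTwoFarthest lam (s i)) (htwo' : HasTwoFarthest lam (s.symm i))
    (hp : lam (s i) j = p) (hpq : p + q = D) (hlt : q < p) :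
    2 ≤ q ∧ ∃ u k, c u = 1 ∧ c k = 1 ∧ lam (s i) u = p ∧ lam i u = D - 1 ∧
      lam (s i) k + q = lam i k ∧ ((3 ≤ q ∧ lam i k = D - 1) ∨ (q = 2 ∧ lam i k = D - 2)) := by
  have hji : lam j i = D := by rw [F.comm, hj]
  have hci : c i = 1 := F.quiddity_eq_one (i := j) (fun l => hji ▸ hmax j l) (by omega)
  have hjne : j ≠ i := F.ne_of_pos (by omega)
  have hq : lam (s.symm i) j = q := by
    have := F.ear_sum hci hjne
    omega
  have hjP : s.symm i ≠ j := by
    intro h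
    have := F.reverse.next i
    rw [h, hj] at this
    omega
  have hq0 : 0 < q := hq ▸ F.pos _ _ hjP
  obtain ⟨u, hu, hup, huD⟩ := F.exists_ne_farthest_next hmax h2 hj huniq htwo
  obtain ⟨k, hk, hkq, hkD⟩ := F.reverse.exists_ne_farthest_next hmax h2 hj huniq htwo'
  rw [hp] at hup
  rw [hq] at hkq
  have hu1 : lam i u = D - 1 := by
    have h₁ := (le_abs_self _).trans ((F.ptolemy i u j).symm.le.trans (hmax u j))
    rw [hj, hp, hup] at h₁
    by_contra hne
    have : lam i u ≤ D - 2 := by omega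
    nlinarith
  have hui : u ≠ i := by
    rintro rfl
    rw [F.self] at hu1
    omega
  have hq2 : 2 ≤ q := by
    by_contra! hq1
    have h₁ := F.ear_sum hci hui
    have h₂ : s.symm i = u := F.eq_of_eq_zero (by omega)
    have h₃ := F.reverse.next i
    rw [h₂, hu1] at h₃
    omega
  have hki : k ≠ i := by
    rintro rfl
    rw [F.reverse.next_symm] at hkq
    omega
  have hks := F.ear_sum hci hki
  have hku := (neg_le_abs _).trans ((F.ptolemy i k u).symm.le.trans (hmax k u))
  rw [hup, hu1, show lam (s i) k = lam i k - q by omega, show p = D - q by omega] at hku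
  refine ⟨hq2, u, k, F.quiddity_eq_one hu (by omega), F.reverse.quiddity_eq_one hk (by omega),
    hup, hu1, by omega, ?_⟩
  rcases hq2.lt_or_eq with hq3 | rfl
  · refine Or.inl ⟨hq3, ?_⟩
    by_contra hne
    have : lam i k ≤ D - 2 := by omega
    nlinarith
  · refine Or.inr ⟨rfl, ?_⟩
    have c₁ := F.reverse.coprime i j
    have c₂ := F.reverse.coprime i k
    rw [hq, hj] at c₁
    rw [hkq] at c₂
    have := Int.emod_two_eq_one_of_isCoprime_two c₁
    have := Int.emod_two_eq_one_of_isCoprime_two c₂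
    have : D - 2 ≤ lam i k := by linarith
    omega

/-- A version of `exists_ears` only referring to the distances from `i` and `j`. -/
theorem exists_ears_of_lt (F : FriezeMetric s c lam) {D : ℤ} (hmax : ∀ a b, lam a b ≤ D)
    (h2 : 2 ≤ D) {i j : ι} (hj : lam i j = D) (huniq : ∀ l, lam i l = D → l = j)
    (htwo : HasTwoFarthest lam (s i)) (htwo' : HasTwoFarthest lam (s.symm i))
    (hlt : D - lam (s i) j < lam (s i) j) :
    ∃ t p q u k, lam i t = 1 ∧ lam t j = p ∧ p + q = D ∧ 2 ≤ q ∧ q < p ∧ c u = 1 ∧ c k = 1 ∧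
      lam i u = D - 1 ∧ lam j u = p ∧
      ((3 ≤ q ∧ lam i k = D - 1 ∧ lam j k = q) ∨ (q = 2 ∧ lam i k = D - 2 ∧ lam j k = 4)) := by
  obtain ⟨hq2, u, k, hu, hk, hup, huD, hkq, h⟩ := F.exists_ears hmax h2 hj huniq htwo htwo' rfl
    (add_sub_cancel (lam (s i) j) D) hlt
  set p := lam (s i) j with hp
  refine ⟨s i, p, D - p, u, k, F.next i, rfl, by ring, hq2, hlt, hu, hk, huD, ?_, ?_⟩
  · rw [F.ptolemy i, hj, ← hp, huD, hup, abs_sub_comm, show p * D - p * (D - 1) = p by ring,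
      abs_of_pos (by omega)]
  · have hjk : lam j k = (D - p) * (D - lam i k) := by
      rw [F.ptolemy i, hj, ← hp, show lam (s i) k = lam i k - (D - p) by omega, abs_sub_comm,
        ← abs_neg,
        show -((lam i k - (D - p)) * D - p * lam i k) = (D - p) * (D - lam i k) by ring,
        abs_of_nonneg]
      exact mul_nonneg (by omega) (sub_nonneg.2 (hmax _ _))
    rcases h with ⟨h₁, h₂⟩ | ⟨h₁, h₂⟩
    · refine Or.inl ⟨h₁, h₂, ?_⟩
      rw [hjk, h₂]
      ring
    · refine Or.inr ⟨h₁, h₂, ?_⟩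
      rw [hjk, h₂, h₁]
      ring

/-- `lam (s i) j` is not half of the maximal distance, unless the latter is two. -/
theorem sub_ne_self (F : FriezeMetric s c lam) {D : ℤ} (h3 : 3 ≤ D) {i j : ι}
    (hj : lam i j = D) : D - lam (s i) j ≠ lam (s i) j := by
  intro h
  have hc := F.coprime i j
  rw [hj, show D = 2 * lam (s i) j by omega, IsCoprime.mul_left_iff, isCoprime_self,
    Int.isUnit_iff] at hc
  omega

theorem lam_symm_add (F : FriezeMetric s c lam) {D : ℤ} (hmax : ∀ a b, lam a b ≤ D)
    (h2 : 2 ≤ D) {i j : ι} (hj : lam i j = D) : lam (s.symm i) j + lam (s i) j = D := by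
  have hji : lam j i = D := by rw [F.comm, hj]
  have hci : c i = 1 := F.quiddity_eq_one (i := j) (fun l => hji ▸ hmax j l) (by omega)
  rw [F.ear_sum hci (F.ne_of_pos (by omega)), hj]

/-- Following the boundary from the ear `e` to the next ear `l`, in the coordinates given by `s i`
and `i`. -/
theorem ear_step_coords (F : FriezeMetric s c lam) {i e l : ι} {x y a b : ℤ} (hl : c l = 1)
    (hx : lam (s i) l = x) (hy : lam i l = y) (ha : lam (s i) (s e) = a)
    (hb : lam i (s e) = b) (hel : e ≠ l) (hx0 : 0 < x) (hy0 : 0 < y)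
    (h : |x * b - a * y| = 1) :
    s (s e) = l ∧ lam (s i) (s l) = x - a ∧ lam i (s l) = y - b := by
  have hss : s (s e) = l := F.ear_step hl hel (by rw [F.ptolemy i, hx, hy, ha, hb, h])
  refine ⟨hss, ?_, ?_⟩
  · rw [F.lam_next_ear hl hss (F.ne_of_pos (by omega)), hx, ha]
  · rw [F.lam_next_ear hl hss (F.ne_of_pos (by omega)), hy, hb]

theorem quiddity_eq_coords (F : FriezeMetric s c lam) {e l : ι} (h : s (s e) = l) (i : ι) :
    c (s e) = |lam (s i) e * lam i l - lam (s i) l * lam i e| := by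
  rw [F.quiddity_eq, h, F.ptolemy i]

theorem isQuad_of_two (F : FriezeMetric s c lam) (hmax : ∀ a b, lam a b ≤ 2) {i j : ι}
    (hj : lam i j = 2) : IsQuad s c := by
  have hji : lam j i = 2 := by rw [F.comm, hj]
  have hci : c i = 1 := F.quiddity_eq_one (i := j) (fun l => hji ▸ hmax j l) (by omega)
  have hcj : c j = 1 := F.quiddity_eq_one (i := i) (fun l => hj ▸ hmax i l) (by omega)
  have key : ∀ {a b}, lam a b = 2 → lam (s a) b = 1 := by
    intro a b h
    have h₁ := F.coprime a b
    have h₂ := F.nonneg (s a) b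
    have h₃ := hmax (s a) b
    rw [h] at h₁
    have := Int.emod_two_eq_one_of_isCoprime_two h₁.symm
    omega
  have hne : i ≠ j := F.ne_of_pos (by omega)
  have h₁ := F.ear_step hcj hne (by rw [F.comm, key hj])
  have h₂ := F.ear_step hci hne.symm (by rw [F.comm, key hji])
  refine ⟨i, j, hne, h₁, h₂, hci, hcj, ?_, ?_⟩
  · rw [F.quiddity_eq, h₁, hj]
  · rw [F.quiddity_eq, h₂, hji]

end FriezeMetric

/-- The arithmetic constraint in the case of two large neighbour distances. -/
theorem eight_of_distance_bounds {D p q p' q' x y : ℤ} (hpq : p + q = D) (hq : 3 ≤ q)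
    (hqp : q < p) (hpq' : p' + q' = D) (hq' : 3 ≤ q') (hqp' : q' < p') (hx0 : 0 ≤ x)
    (hx : |p * p' - x * D| = D - 1) (hxu : |p * p' - x * (D - 1)| ≤ D)
    (hxk : |(p - 1) * p' - x * (D - 1)| ≤ D)
    (hy : |p * q' - y * D| = D - 1) (hyu : |p * q' - y * (D - 1)| ≤ D) :
    D = 8 ∧ p = 5 ∧ q = 3 ∧ p' = 5 ∧ q' = 3 ∧ x = 4 ∧ y = 1 := by
  rw [abs_le] at hxu hxk hyu
  rw [abs_eq (by omega)] at hx hy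
  obtain hx | hx := hx
  · exfalso
    have hx1 : x ≤ 1 := by linarith
    have hpp : p * p' ≤ 2 * D - 1 := by nlinarith
    nlinarith
  · have hxp : p' - 1 ≤ x := by linarith
    have h₁ : p' * q ≤ 2 * D - 1 := by nlinarith
    have hq3 : q = 3 := by
      by_contra hne
      have : 4 ≤ q := by omega
      nlinarith
    subst hq3
    obtain rfl : p = D - 3 := by omega
    obtain rfl : p' = D - q' := by omega
    have hdvd : D * (D - q' - 3 - x + 1) = 1 - 3 * q' := by linarith
    have hm : D - q' - 3 - x + 1 = -1 := by
      have hlo : -2 < D - q' - 3 - x + 1 := by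
        by_contra! hle
        nlinarith
      have hhi : D - q' - 3 - x + 1 < 0 := by
        by_contra! hle
        nlinarith
      omega
    rw [hm] at hdvd
    obtain rfl : D = 3 * q' - 1 := by linarith
    obtain rfl : x = 2 * q' - 2 := by linarith
    obtain hy | hy := hy
    · have hyq : (3 * q' - 1) * (y - (q' - 2)) = 0 := by linarith
      have : y = q' - 2 := by
        rcases mul_eq_zero.1 hyq with h | h <;> omega
      subst this
      have : q' = 3 := by nlinarith
      subst this
      norm_num
    · exfalso
      have hyq : (3 * q' - 1) * (q' - y) = 2 := by linarith
      have : 0 < q' - y := by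
        by_contra! hle
        nlinarith
      nlinarith

theorem eq_two_mul_add_one_of_abs_eq_one {D p q m : ℤ} (hpq : p + q = D) (hq : 2 ≤ q)
    (hqp : q < p) (hm : |(D - 2) * p - m * D| = 1) : D = 2 * q + 1 := by
  have hlo : 0 < p - m := by
    rcases (abs_eq (by norm_num)).1 hm with h | h <;> by_contra! hle <;> nlinarith
  have hhi : p - m < 2 := by
    rcases (abs_eq (by norm_num)).1 hm with h | h <;> by_contra! hle <;> nlinarith
  obtain rfl : m = p - 1 := by omega
  rcases (abs_eq (by norm_num)).1 hm with h | h <;> linarith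

/-- The arithmetic constraint in the case of a neighbour at distance two. -/
theorem five_of_distance_bounds {D p q m y : ℤ} (hpq : p + q = D) (hq : 2 ≤ q)
    (hqp : q < p) (hm : |(D - 2) * p - m * D| = 1)
    (hy : 3 ≤ q → |(D - 2) * q - y * D| = D - 1 ∧ IsCoprime q y) :
    q = 2 ∧ D = 5 ∧ p = 3 := by
  obtain rfl := eq_two_mul_add_one_of_abs_eq_one hpq hq hqp hm
  by_cases h3 : 3 ≤ q
  · exfalso
    obtain ⟨hy, hc⟩ := hy h3
    rcases (abs_eq (by omega)).1 hy with hy | hy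
    · have h₁ : (2 * q + 1) * (q - y) = 4 * q := by linarith
      have h₂ : 0 < q - y := by
        by_contra! hle
        nlinarith
      have h₃ : q - y < 2 := by
        by_contra! hle
        nlinarith
      have h₄ : q - y = 1 := by omega
      rw [h₄] at h₁
      omega
    · have h₁ : (2 * q + 1) * (y - q) = 0 := by linarith
      obtain rfl : y = q := by
        rcases mul_eq_zero.1 h₁ with h | h <;> omega
      rw [isCoprime_self, Int.isUnit_iff] at hc
      omega
  · omega

namespace FriezeMetric

variable {ι : Type*} {s : Equiv.Perm ι} {c : ι → ℤ} {lam : ι → ι → ℤ}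

theorem isOcta_of_coords (F : FriezeMetric s c lam) {i k j u : ι} (hi : c i = 1) (hk : c k = 1)
    (hj : c j = 1) (hu : c u = 1) (kx : lam (s i) k = 1) (ky : lam i k = 3)
    (jx : lam (s i) j = 3) (jy : lam i j = 5) (ux : lam (s i) u = 3) (uy : lam i u = 4) :
    IsOcta s c := by
  have ix : lam (s i) i = 1 := F.next_symm i
  have iy : lam i i = 0 := F.self i
  have sx : lam (s i) (s i) = 0 := F.self _
  have sy : lam i (s i) = 1 := F.next i
  have ne : ∀ {a b}, lam i a ≠ lam i b → a ≠ b := fun h h' => h (by rw [h'])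
  obtain ⟨h₀, x₁, y₁⟩ := F.ear_step_coords hk kx ky sx sy (ne (by omega)) (by norm_num)
    (by norm_num) (by norm_num)
  obtain ⟨h₁, x₂, y₂⟩ := F.ear_step_coords hj jx jy x₁ y₁ (ne (by omega)) (by norm_num)
    (by norm_num) (by norm_num)
  obtain ⟨h₂, x₃, y₃⟩ := F.ear_step_coords hu ux uy x₂ y₂ (ne (by omega)) (by norm_num)
    (by norm_num) (by norm_num)
  have h₃ := F.ear_step (e := u) (l := i) hi (ne (by omega)) (by rw [y₃]; norm_num)
  refine ⟨i, k, j, u, ne (by omega), h₀, h₁, h₂, h₃, hi, hk, hj, hu, ?_, ?_, ?_, ?_⟩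
  · rw [F.quiddity_eq_coords h₀ i, ix, iy, kx, ky]; norm_num
  · rw [F.quiddity_eq_coords h₁ i, kx, ky, jx, jy]; norm_num
  · rw [F.quiddity_eq_coords h₂ i, jx, jy, ux, uy]; norm_num
  · rw [F.quiddity_eq_coords h₃ i, ux, uy, ix, iy]; norm_num

theorem isDodeca_of_coords (F : FriezeMetric s c lam) {i k' k j u u' : ι} (hi : c i = 1)
    (hk' : c k' = 1) (hk : c k = 1) (hj : c j = 1) (hu : c u = 1) (hu' : c u' = 1)
    (kx' : lam (s i) k' = 1) (ky' : lam i k' = 3) (kx : lam (s i) k = 4) (ky : lam i k = 7)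
    (jx : lam (s i) j = 5) (jy : lam i j = 8) (ux : lam (s i) u = 5) (uy : lam i u = 7)
    (ux' : lam (s i) u' = 4) (uy' : lam i u' = 5) : IsDodeca s c := by
  have ix : lam (s i) i = 1 := F.next_symm i
  have iy : lam i i = 0 := F.self i
  have sx : lam (s i) (s i) = 0 := F.self _
  have sy : lam i (s i) = 1 := F.next i
  have ne : ∀ {a b}, lam i a ≠ lam i b → a ≠ b := fun h h' => h (by rw [h'])
  obtain ⟨h₀, x₁, y₁⟩ := F.ear_step_coords hk' kx' ky' sx sy (ne (by omega)) (by norm_num)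
    (by norm_num) (by norm_num)
  obtain ⟨h₁, x₂, y₂⟩ := F.ear_step_coords hk kx ky x₁ y₁ (ne (by omega)) (by norm_num)
    (by norm_num) (by norm_num)
  obtain ⟨h₂, x₃, y₃⟩ := F.ear_step_coords hj jx jy x₂ y₂ (ne (by omega)) (by norm_num)
    (by norm_num) (by norm_num)
  obtain ⟨h₃, x₄, y₄⟩ := F.ear_step_coords hu ux uy x₃ y₃ (ne (by omega)) (by norm_num)
    (by norm_num) (by norm_num)
  obtain ⟨h₄, x₅, y₅⟩ := F.ear_step_coords hu' ux' uy' x₄ y₄ (ne (by omega)) (by norm_num)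
    (by norm_num) (by norm_num)
  have h₅ := F.ear_step (e := u') (l := i) hi (ne (by omega)) (by rw [y₅]; norm_num)
  refine ⟨i, k', k, j, u, u', ne (by omega), ne (by omega), h₀, h₁, h₂, h₃, h₄, h₅,
    hi, hk', hk, hj, hu, hu', ?_, ?_, ?_, ?_, ?_, ?_⟩
  · rw [F.quiddity_eq_coords h₀ i, ix, iy, kx', ky']; norm_num
  · rw [F.quiddity_eq_coords h₁ i, kx', ky', kx, ky]; norm_num
  · rw [F.quiddity_eq_coords h₂ i, kx, ky, jx, jy]; norm_num
  · rw [F.quiddity_eq_coords h₃ i, jx, jy, ux, uy]; norm_num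
  · rw [F.quiddity_eq_coords h₄ i, ux, uy, ux', uy']; norm_num
  · rw [F.quiddity_eq_coords h₅ i, ux', uy', ix, iy]; norm_num

theorem isOcta_or_isDodeca_of_lt (F : FriezeMetric s c lam) {D : ℤ}
    (hmax : ∀ a b, lam a b ≤ D) (h3 : 3 ≤ D)
    (huniq : ∀ a b l, lam a b = D → lam a l = D → l = b)
    (htwo : ∀ a b, lam a b = D → HasTwoFarthest lam (s a) ∧ HasTwoFarthest lam (s.symm a))
    {i j : ι} (hij : lam i j = D) (hlt : D - lam (s i) j < lam (s i) j) :
    IsOcta s c ∨ IsDodeca s c := by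
  have h2 : 2 ≤ D := by omega
  have hji : lam j i = D := by rw [F.comm, hij]
  have hci : c i = 1 := F.quiddity_eq_one (i := j) (fun l => hji ▸ hmax j l) (by omega)
  have hcj : c j = 1 := F.quiddity_eq_one (i := i) (fun l => hij ▸ hmax i l) (by omega)
  obtain ⟨p, hp⟩ : ∃ p, lam (s i) j = p := ⟨_, rfl⟩
  obtain ⟨q, hpq⟩ : ∃ q, p + q = D := ⟨D - p, by ring⟩
  rw [hp] at hlt
  have hqp : q < p := by omega
  obtain ⟨hq2, u, k, hu, hk, hup, huD, hkq, hz⟩ := F.exists_ears hmax h2 hij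
    (fun l hl => huniq i j l hij hl) (htwo i j hij).1 (htwo i j hij).2 hp hpq hqp
  have hback : ∃ t p q u k, lam j t = 1 ∧ lam t i = p ∧ p + q = D ∧ 2 ≤ q ∧ q < p ∧ c u = 1 ∧
      c k = 1 ∧ lam j u = D - 1 ∧ lam i u = p ∧
      ((3 ≤ q ∧ lam j k = D - 1 ∧ lam i k = q) ∨
        (q = 2 ∧ lam j k = D - 2 ∧ lam i k = 4)) := by
    have hadd := F.lam_symm_add hmax h2 hji
    rcases (F.sub_ne_self h3 hji).lt_or_gt with h | h
    · exact F.exists_ears_of_lt hmax h2 hji (fun l hl => huniq j i l hji hl) (htwo j i hji).1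
        (htwo j i hji).2 h
    · exact F.reverse.exists_ears_of_lt hmax h2 hji (fun l hl => huniq j i l hji hl)
        (htwo j i hji).2 (htwo j i hji).1 (by omega)
  obtain ⟨t, p', q', u', k', hjt, hti, hpq', hq2', hqp', hu', hk', hju', hiu', hz'⟩ := hback
  rw [F.comm] at hti
  rw [F.ptolemy i j, hp, hij, hti] at hjt
  rw [F.ptolemy i j, hp, hij, hiu'] at hju'
  rcases hz with ⟨hq3, hkz⟩ | ⟨rfl, hkz⟩
  · have hkx : lam (s i) k = p - 1 := by omega
    rcases hz' with ⟨hq3', hjk', hik'⟩ | ⟨rfl, -, -⟩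
    · right
      rw [F.ptolemy i j, hp, hij, hik'] at hjk'
      have b₁ := hmax u u'
      have b₂ := hmax k u'
      have b₃ := hmax u k'
      rw [F.ptolemy i, hup, huD, hiu'] at b₁
      rw [F.ptolemy i, hkx, hkz, hiu'] at b₂
      rw [F.ptolemy i, hup, huD, hik'] at b₃
      obtain ⟨rfl, rfl, rfl, rfl, rfl, hx, hy⟩ := eight_of_distance_bounds hpq hq3 hqp hpq' hq3'
        hqp' (F.nonneg _ _) hju' b₁ b₂ hjk' b₃
      exact F.isDodeca_of_coords hci hk' hk hcj hu hu' hy hik' hkx hkz hp hij hup huD hx hiu'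
    · exfalso
      obtain rfl : p' = D - 2 := by omega
      have hD := eq_two_mul_add_one_of_abs_eq_one (m := lam (s i) t) hpq hq2 hqp
        (by rw [← hjt]; ring_nf)
      have hc := F.coprime i k
      rw [hkz, hkx, show D - 1 = 2 * q by omega, show p - 1 = q by omega,
        IsCoprime.mul_left_iff, isCoprime_self, Int.isUnit_iff] at hc
      omega
  · left
    obtain rfl : p = D - 2 := by omega
    have := five_of_distance_bounds (y := lam (s i) k') hpq' hq2' hqp' hjt (by
      intro h
      rcases hz' with ⟨-, hjk', hik'⟩ | ⟨rfl, -, -⟩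
      · rw [F.ptolemy i j, hp, hij, hik'] at hjk'
        refine ⟨hjk', ?_⟩
        rw [← hik']
        exact F.coprime i k'
      · omega)
    obtain ⟨rfl, rfl, rfl⟩ := this
    exact F.isOcta_of_coords hci hk hcj hu (by omega) hkz hp hij hup huD

end FriezeMetric

namespace FriezeMetric

variable {ι : Type*} {s : Equiv.Perm ι} {c : ι → ℤ} {lam : ι → ι → ℤ}

/-- The classification of dense friezes. -/
theorem classification [Finite ι] [Nonempty ι] (F : FriezeMetric s c lam)
    (hd : ∀ a, HasTwoFarthest lam a ∨ HasTwoFarthest lam (s a)) :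
    IsTri s c ∨ IsQuad s c ∨ IsHexa s c ∨ IsOcta s c ∨ IsDodeca s c := by
  obtain ⟨⟨i, j⟩, hij⟩ := Finite.exists_max fun x : ι × ι => lam x.1 x.2
  obtain ⟨D, hD⟩ : ∃ D, lam i j = D := ⟨_, rfl⟩
  have hmax : ∀ a b, lam a b ≤ D := fun a b => hD ▸ hij (a, b)
  have hD1 : 1 ≤ D := F.next i ▸ hmax i (s i)
  rcases hD1.eq_or_lt with rfl | h2
  · left
    rcases hd i with h | h <;> exact F.isTri_of_le_one hmax h
  right
  by_cases hA : ∃ a b l, lam a b = D ∧ lam a l = D ∧ b ≠ l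
  · obtain ⟨a, b, l, hb, hl, hne⟩ := hA
    exact Or.inr (Or.inl (F.isHexa_of_two hmax h2 hd hne hb hl))
  push Not at hA
  rcases (show 2 ≤ D from h2).eq_or_lt with rfl | h3
  · exact Or.inl (F.isQuad_of_two hmax hD)
  right; right
  have hnot : ∀ a b, lam a b = D → ¬ HasTwoFarthest lam a := by
    rintro a b hab ⟨k, l, hne, hk, hl⟩
    exact hne (hA a k l (le_antisymm (hmax _ _) (hab ▸ hk b)) (le_antisymm (hmax _ _) (hab ▸ hl b)))
  have htwo : ∀ a b, lam a b = D → HasTwoFarthest lam (s a) ∧ HasTwoFarthest lam (s.symm a) := by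
    intro a b hab
    refine ⟨(hd a).resolve_left (hnot a b hab), (hd (s.symm a)).resolve_right ?_⟩
    rw [s.apply_symm_apply]
    exact hnot a b hab
  have huniq : ∀ a b l, lam a b = D → lam a l = D → l = b :=
    fun a b l hb hl => (hA a b l hb hl).symm
  have hadd := F.lam_symm_add hmax h2 hD
  rcases (F.sub_ne_self h3 hD).lt_or_gt with h | h
  · exact F.isOcta_or_isDodeca_of_lt hmax h3 huniq htwo hD h
  · exact (F.reverse.isOcta_or_isDodeca_of_lt hmax h3 huniq
      (fun a b hab => (htwo a b hab).symm) hD (by omega)).imp IsOcta.of_symm IsDodeca.of_symm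

end FriezeMetric

/-- A cyclic family of plane vectors `(x l, y l)`, antiperiodic of period `w.length`, realizing the
sequence `w` as its quiddity cycle. -/
structure IsVectorRealization (w : List ℤ) (x y : ℕ → ℤ) : Prop where
  two_le : 2 ≤ w.length
  x_length : x w.length = -x 0
  y_length : y w.length = -y 0
  x_length_succ : x (w.length + 1) = -x 1
  y_length_succ : y (w.length + 1) = -y 1
  x_rel : ∀ l (h : l < w.length), w[l] * x (l + 1) = x l + x (l + 2)
  y_rel : ∀ l (h : l < w.length), w[l] * y (l + 1) = y l + y (l + 2)
  det_zero : x 0 * y 1 - x 1 * y 0 = 1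
  det_pos : ∀ a b, 1 ≤ a → a < b → b ≤ w.length → 0 < x a * y b - x b * y a

namespace IsVectorRealization

variable {w : List ℤ} {x y : ℕ → ℤ}

theorem det_succ (h : IsVectorRealization w x y) (l : ℕ) (hl : l ≤ w.length) :
    x l * y (l + 1) - x (l + 1) * y l = 1 := by
  induction l with
  | zero => exact h.det_zero
  | succ l ih =>
    have h₁ := h.x_rel l hl
    have h₂ := h.y_rel l hl
    rw [← ih (by omega), show x (l + 1 + 1) = w[l] * x (l + 1) - x l by linarith,
      show y (l + 1 + 1) = w[l] * y (l + 1) - y l by linarith]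
    ring

theorem det_nonneg (h : IsVectorRealization w x y) {a b : ℕ} (hab : a ≤ b)
    (hba : b ≤ a + w.length) (hb : b ≤ w.length + 1) : 0 ≤ x a * y b - x b * y a := by
  have main : ∀ a b, 1 ≤ a → a ≤ b → b ≤ w.length → 0 ≤ x a * y b - x b * y a := by
    intro a b ha hab hb
    rcases hab.eq_or_lt with rfl | hlt
    · linarith
    · exact (h.det_pos a b ha hlt hb).le
  rcases Nat.eq_zero_or_pos a with rfl | ha
  · rcases Nat.eq_zero_or_pos b with rfl | hb0
    · linarith
    · have := main b w.length hb0 (by omega) le_rfl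
      rw [h.x_length, h.y_length] at this
      linarith
  · rcases Nat.lt_or_ge w.length b with hlt | hle
    · obtain rfl : b = w.length + 1 := by omega
      rcases Nat.lt_or_ge w.length a with hlt' | hle'
      · obtain rfl : a = w.length + 1 := by omega
        linarith
      · have := main 1 a le_rfl ha hle'
        rw [h.x_length_succ, h.y_length_succ]
        linarith
    · exact main a b ha hab hle

theorem rotate (h : IsVectorRealization w x y) :
    IsVectorRealization (w.rotate 1) (fun l => if l ≤ w.length then x (l + 1) else -x 2)
      (fun l => if l ≤ w.length then y (l + 1) else -y 2) := by
  have h2 := h.two_le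
  have hrel : ∀ z : ℕ → ℤ, z w.length = -z 0 → z (w.length + 1) = -z 1 →
      (∀ l (h : l < w.length), w[l] * z (l + 1) = z l + z (l + 2)) →
      ∀ l (h : l < (w.rotate 1).length),
        (w.rotate 1)[l] * (if l + 1 ≤ w.length then z (l + 1 + 1) else -z 2) =
        (if l ≤ w.length then z (l + 1) else -z 2) +
          (if l + 2 ≤ w.length then z (l + 2 + 1) else -z 2) := by
    intro z hz hz' hr l hl
    rw [List.length_rotate] at hl
    rw [List.getElem_rotate, if_pos (by omega), if_pos (by omega)]
    rcases Nat.lt_or_ge (l + 1) w.length with hlt | hge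
    · simp only [Nat.mod_eq_of_lt hlt]
      rw [if_pos (by omega)]
      exact hr (l + 1) hlt
    · obtain hl1 : l + 1 = w.length := by omega
      simp only [hl1, Nat.mod_self]
      rw [if_neg (by omega), hz', hz]
      have := hr 0 (by omega)
      simp only [zero_add] at this
      linarith
  refine ⟨by simpa using h2, ?_, ?_, ?_, ?_, hrel x h.x_length h.x_length_succ h.x_rel,
    hrel y h.y_length h.y_length_succ h.y_rel, ?_, ?_⟩
  · simpa using h.x_length_succ
  · simpa using h.y_length_succ
  · simp [show 1 ≤ w.length by omega]
  · simp [show 1 ≤ w.length by omega]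
  · simpa [show 1 ≤ w.length by omega] using h.det_succ 1 (by omega)
  · intro a b ha hab hb
    rw [List.length_rotate] at hb
    simp only [if_pos hb, if_pos (show a ≤ w.length by omega)]
    rcases hb.lt_or_eq with hlt | heq
    · exact h.det_pos _ _ (by omega) (by omega) (by omega)
    · rw [heq, h.x_length_succ, h.y_length_succ]
      have := h.det_pos 1 (a + 1) le_rfl (by omega) (by omega)
      linarith

theorem reverse (h : IsVectorRealization w x y) :
    IsVectorRealization w.reverse (fun l => y (w.length + 1 - l))
      (fun l => x (w.length + 1 - l)) := by
  have h2 := h.two_le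
  have hrel : ∀ z : ℕ → ℤ, (∀ l (h : l < w.length), w[l] * z (l + 1) = z l + z (l + 2)) →
      ∀ l (h : l < w.reverse.length), w.reverse[l] * z (w.length + 1 - (l + 1)) =
        z (w.length + 1 - l) + z (w.length + 1 - (l + 2)) := by
    intro z hr l hl
    rw [List.length_reverse] at hl
    rw [List.getElem_reverse]
    have := hr (w.length - 1 - l) (by omega)
    rw [show w.length - 1 - l + 1 = w.length + 1 - (l + 1) by omega,
      show w.length - 1 - l + 2 = w.length + 1 - l by omega] at this
    have hz : z (w.length - 1 - l) = z (w.length + 1 - (l + 2)) := congrArg z (by omega)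
    linarith
  refine ⟨by simpa using h2, ?_, ?_, ?_, ?_, hrel y h.y_rel, hrel x h.x_rel, ?_, ?_⟩
  · simp [h.y_length_succ]
  · simp [h.x_length_succ]
  · simp [h.y_length]
  · simp [h.x_length]
  · have := h.det_succ w.length le_rfl
    simp only [Nat.sub_zero, Nat.add_sub_cancel]
    linarith
  · intro a b ha hab hb
    rw [List.length_reverse] at hb
    have := h.det_pos (w.length + 1 - b) (w.length + 1 - a) (by omega) (by omega) (by omega)
    linarith

/-- Insertion of the value `z 1 + z 2` between the values at `1` and `2`. -/
def insertSum (z : ℕ → ℤ) : ℕ → ℤ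
  | 0 => z 0
  | 1 => z 1
  | 2 => z 1 + z 2
  | l + 3 => z (l + 2)

theorem expand {a b : ℤ} {t : List ℤ} (h : IsVectorRealization (a :: b :: t) x y) :
    IsVectorRealization ((a + 1) :: 1 :: (b + 1) :: t) (insertSum x) (insertSum y) := by
  have hrel : ∀ z : ℕ → ℤ, (∀ l (h : l < (a :: b :: t).length),
        (a :: b :: t)[l] * z (l + 1) = z l + z (l + 2)) →
      ∀ l (h : l < ((a + 1) :: 1 :: (b + 1) :: t).length),
        ((a + 1) :: 1 :: (b + 1) :: t)[l] * insertSum z (l + 1) =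
          insertSum z l + insertSum z (l + 2) := by
    intro z hr l hl
    have h₀ := hr 0 (by simp)
    have h₁ := hr 1 (by simp)
    simp at h₀ h₁
    match l with
    | 0 => simp [insertSum]; linarith
    | 1 => simp [insertSum]
    | 2 => simp [insertSum]; linarith
    | l + 3 =>
      simp only [List.length_cons] at hl
      have := hr (l + 2) (by simp; omega)
      simp only [List.getElem_cons_succ] at this ⊢
      exact this
  have x₀ := h.x_length
  have y₀ := h.y_length
  have x₁ := h.x_length_succ
  have y₁ := h.y_length_succ
  simp only [List.length_cons] at x₀ x₁ y₀ y₁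
  refine ⟨by simp, ?_, ?_, ?_, ?_, hrel x h.x_rel, hrel y h.y_rel, ?_, ?_⟩
  · simpa [insertSum] using x₀
  · simpa [insertSum] using y₀
  · simpa [insertSum] using x₁
  · simpa [insertSum] using y₁
  · simpa [insertSum] using h.det_zero
  · intro i j hi hij hj
    have hp := h.det_pos
    simp only [List.length_cons] at hp hj
    match i, j with
    | 1, 2 =>
      have := hp 1 2 le_rfl (by omega) (by omega)
      simp only [insertSum]
      linarith
    | 1, j + 3 => exact hp 1 (j + 2) le_rfl (by omega) (by omega)
    | 2, j + 3 =>
      have h₁ := hp 1 (j + 2) le_rfl (by omega) (by omega)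
      have h₂ := h.det_nonneg (a := 2) (b := j + 2) (by omega) (by simp; omega) (by simp; omega)
      simp only [insertSum]
      linarith
    | i + 3, j + 3 => exact hp (i + 2) (j + 2) (by omega) (by omega) (by omega)

end IsVectorRealization

theorem IsEta.exists_vectorRealization {c : List ℤ} (h : IsEta c) :
    ∃ x y, IsVectorRealization c x y := by
  induction h with
  | base =>
    refine ⟨fun l => if l = 0 then 1 else if l = 2 then -1 else 0,
      fun l => if l = 1 then 1 else if l = 3 then -1 else 0, by simp, by simp, by simp, by simp,
      by simp, ?_, ?_, by simp, ?_⟩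
    · intro l hl
      simp only [List.length_cons, List.length_nil] at hl
      interval_cases l <;> simp
    · intro l hl
      simp only [List.length_cons, List.length_nil] at hl
      interval_cases l <;> simp
    · intro a b ha hab hb
      simp only [List.length_cons, List.length_nil] at hb
      obtain rfl : a = 1 := by omega
      obtain rfl : b = 2 := by omega
      simp
  | rotate _ ih => obtain ⟨x, y, ih⟩ := ih; exact ⟨_, _, ih.rotate⟩
  | reverse _ ih => obtain ⟨x, y, ih⟩ := ih; exact ⟨_, _, ih.reverse⟩
  | expand _ ih => obtain ⟨x, y, ih⟩ := ih; exact ⟨_, _, ih.expand⟩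

/-- The cyclic successor on `Fin n`. -/
def cyclicSucc (n : ℕ) : Equiv.Perm (Fin n) where
  toFun a := ⟨(a + 1) % n, Nat.mod_lt _ a.pos⟩
  invFun a := ⟨(a + (n - 1)) % n, Nat.mod_lt _ a.pos⟩
  left_inv a := by
    have := a.pos
    apply Fin.ext
    simp only [Nat.mod_add_mod]
    rw [show (a : ℕ) + 1 + (n - 1) = a + n by omega, Nat.add_mod_right, Nat.mod_eq_of_lt a.2]
  right_inv a := by
    have := a.pos
    apply Fin.ext
    simp only [Nat.mod_add_mod]
    rw [show (a : ℕ) + (n - 1) + 1 = a + n by omega, Nat.add_mod_right, Nat.mod_eq_of_lt a.2]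

theorem val_cyclicSucc {n : ℕ} (a : Fin n) : (cyclicSucc n a : ℕ) = (a + 1) % n := rfl

theorem val_cyclicSucc_symm {n : ℕ} (a : Fin n) :
    ((cyclicSucc n).symm a : ℕ) = (a + (n - 1)) % n := rfl

/-- The absolute value of the determinant of the `a`-th and the `b`-th vector of the family
`(x l, y l)`. -/
def absDet (x y : ℕ → ℤ) (a b : ℕ) : ℤ := |x a * y b - x b * y a|

theorem absDet_comm (x y : ℕ → ℤ) (a b : ℕ) : absDet x y a b = absDet x y b a := by
  unfold absDet
  rw [← abs_neg]
  congr 1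
  ring

theorem absDet_of_nonneg {x y : ℕ → ℤ} {a b : ℕ} (h : 0 ≤ x a * y b - x b * y a) :
    absDet x y a b = x a * y b - x b * y a := abs_of_nonneg h

theorem absDet_of_nonpos {x y : ℕ → ℤ} {a b : ℕ} (h : 0 ≤ x b * y a - x a * y b) :
    absDet x y a b = x b * y a - x a * y b := by
  rw [absDet_comm, absDet_of_nonneg h]

namespace IsVectorRealization

variable {w : List ℤ} {x y : ℕ → ℤ}

theorem absDet_cyclicSucc (h : IsVectorRealization w x y) (a : Fin w.length) (b : ℕ) :
    absDet x y (cyclicSucc _ a + 1) b = absDet x y (a + 2) b := by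
  rw [val_cyclicSucc]
  rcases Nat.lt_or_ge (a + 1) w.length with hlt | hge
  · rw [Nat.mod_eq_of_lt hlt]
  · have ha := a.2
    have e : (a : ℕ) + 1 = w.length := by omega
    rw [show (a : ℕ) + 2 = w.length + 1 by omega, e, Nat.mod_self]
    unfold absDet
    rw [h.x_length_succ, h.y_length_succ, ← abs_neg]
    congr 1
    ring

theorem absDet_cyclicSucc_symm (h : IsVectorRealization w x y) (a : Fin w.length) (b : ℕ) :
    absDet x y ((cyclicSucc _).symm a + 1) b = absDet x y a b := by
  have ha := a.2
  rw [val_cyclicSucc_symm]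
  rcases Nat.eq_zero_or_pos (a : ℕ) with h0 | hpos
  · rw [h0, zero_add, Nat.mod_eq_of_lt (by omega), show w.length - 1 + 1 = w.length by omega]
    unfold absDet
    rw [h.x_length, h.y_length, ← abs_neg]
    congr 1
    ring
  · rw [show (a : ℕ) + (w.length - 1) = a - 1 + w.length by omega, Nat.add_mod_right,
      Nat.mod_eq_of_lt (by omega), show (a : ℕ) - 1 + 1 = a by omega]

theorem friezeMetric (h : IsVectorRealization w x y) :
    FriezeMetric (cyclicSucc w.length) (fun a => w[a])
      (fun a b => absDet x y (a + 1) (b + 1)) where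
  comm a b := absDet_comm x y _ _
  self a := by simp [absDet]
  pos a b hab := by
    have ha := a.2
    have hb := b.2
    apply abs_pos.2
    rcases lt_or_gt_of_ne (Fin.val_ne_of_ne hab) with hlt | hgt
    · exact (h.det_pos (a + 1) (b + 1) (by omega) (by omega) (by omega)).ne'
    · have := h.det_pos (b + 1) (a + 1) (by omega) (by omega) (by omega)
      linarith
  next a := by
    have ha := a.2
    rw [absDet_comm, h.absDet_cyclicSucc, absDet_comm]
    unfold absDet
    rw [h.det_succ (a + 1) (by omega), abs_one]
  ptolemy i k l := by
    have hi := i.2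
    simp only [h.absDet_cyclicSucc]
    have hdet := h.det_succ (i + 1) (by omega)
    have key : x (k + 1) * y (l + 1) - x (l + 1) * y (k + 1) =
        -((x (i + 2) * y (k + 1) - x (k + 1) * y (i + 2)) *
          (x (i + 1) * y (l + 1) - x (l + 1) * y (i + 1)) -
        (x (i + 2) * y (l + 1) - x (l + 1) * y (i + 2)) *
          (x (i + 1) * y (k + 1) - x (k + 1) * y (i + 1))) := by
      rw [← mul_one (x (k + 1) * y (l + 1) - x (l + 1) * y (k + 1)), ← hdet]
      ring
    have hsign : ∀ j : Fin w.length, ∃ e : ℤ, (e = 1 ∨ e = -1) ∧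
        absDet x y (i + 2) (j + 1) = e * (x (i + 2) * y (j + 1) - x (j + 1) * y (i + 2)) ∧
        absDet x y (i + 1) (j + 1) = e * (x (i + 1) * y (j + 1) - x (j + 1) * y (i + 1)) := by
      intro j
      have hj := j.2
      rcases Nat.lt_or_ge i j with hlt | hge
      · refine ⟨1, Or.inl rfl, ?_, ?_⟩
        · rw [absDet_of_nonneg (h.det_nonneg (by omega) (by omega) (by omega)), one_mul]
        · rw [absDet_of_nonneg (h.det_nonneg (by omega) (by omega) (by omega)), one_mul]
      · refine ⟨-1, Or.inr rfl, ?_, ?_⟩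
        · rw [absDet_of_nonpos (h.det_nonneg (by omega) (by omega) (by omega))]
          ring
        · rw [absDet_of_nonpos (h.det_nonneg (by omega) (by omega) (by omega))]
          ring
    obtain ⟨e, he, hk₂, hk₁⟩ := hsign k
    obtain ⟨f, hf, hl₂, hl₁⟩ := hsign l
    rw [hk₂, hk₁, hl₂, hl₁]
    unfold absDet
    rw [key, abs_neg]
    rcases he with rfl | rfl <;> rcases hf with rfl | rfl <;> simp only [one_mul, neg_mul, mul_neg,
      neg_neg, sub_neg_eq_add]
    · rw [← abs_neg]; congr 1; ring
    · rw [← abs_neg]; congr 1; ring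
  sum i l hl := by
    have hi := i.2
    have hl2 := l.2
    simp only [h.absDet_cyclicSucc, h.absDet_cyclicSucc_symm]
    have hx := h.x_rel i hi
    have hy := h.y_rel i hi
    simp only [Fin.getElem_fin]
    rcases lt_or_gt_of_ne (Fin.val_ne_of_ne hl) with hlt | hgt
    · rw [absDet_of_nonpos (h.det_nonneg (by omega) (by omega) (by omega)),
        absDet_of_nonpos (h.det_nonneg (by omega) (by omega) (by omega)),
        absDet_of_nonpos (h.det_nonneg (by omega) (by omega) (by omega))]
      linear_combination y (l + 1) * hx - x (l + 1) * hy
    · rw [absDet_of_nonneg (h.det_nonneg (by omega) (by omega) (by omega)),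
        absDet_of_nonneg (h.det_nonneg (by omega) (by omega) (by omega)),
        absDet_of_nonneg (h.det_nonneg (by omega) (by omega) (by omega))]
      linear_combination x (l + 1) * hy - y (l + 1) * hx

theorem prod_etaM (h : IsVectorRealization w x y) (i m : ℕ) (him : i + m ≤ w.length) :
    (((w.drop i).take m).map etaM).prod 1 0 =
        x (i + 1) * y (i + 1 + m) - x (i + 1 + m) * y (i + 1) ∧
    (((w.drop i).take m).map etaM).prod 1 1 = -(x (i + 1) * y (i + m) - x (i + m) * y (i + 1)) := by
  induction m with
  | zero =>
    have := h.det_succ i (by omega)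
    simp
    linarith
  | succ m ih =>
    obtain ⟨ih₀, ih₁⟩ := ih (by omega)
    have hx := h.x_rel (i + m) (by omega)
    have hy := h.y_rel (i + m) (by omega)
    rw [List.take_add_one, List.getElem?_eq_getElem (by simp; omega), List.getElem_drop]
    simp only [Option.toList_some, List.map_append, List.map_cons, List.map_nil, List.prod_append,
      List.prod_cons, List.prod_nil, mul_one, Matrix.mul_apply, Fin.sum_univ_two, ih₀, ih₁]
    simp only [etaM, Matrix.of_apply, Matrix.cons_val', Matrix.cons_val_zero, Matrix.cons_val_one,
      Matrix.cons_val_fin_one]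
    rw [show i + (m + 1) = i + m + 1 by omega, show i + 1 + (m + 1) = i + m + 2 by omega,
      show i + 1 + m = i + m + 1 by omega]
    constructor
    · linear_combination x (i + 1) * hy - y (i + 1) * hx
    · ring

theorem phi_eq_absDet (h : IsVectorRealization w x y) (a b : Fin w.length) :
    phi w (a + 1) (b + 1) = absDet x y (a + 1) (b + 1) := by
  have ha := a.2
  have hb := b.2
  unfold phi
  rcases lt_trichotomy (a : ℕ) b with hlt | heq | hgt
  · rw [if_neg (by omega), if_pos (by omega), Nat.add_sub_cancel,
      (h.prod_etaM a _ (by omega)).1, show (a : ℕ) + 1 + (b + 1 - (a + 1)) = b + 1 by omega,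
      absDet_of_nonneg (h.det_nonneg (by omega) (by omega) (by omega))]
  · rw [if_pos (by omega), heq]
    simp [absDet]
  · rw [if_neg (by omega), if_neg (by omega), Nat.add_sub_cancel,
      (h.prod_etaM b _ (by omega)).1, show (b : ℕ) + 1 + (a + 1 - (b + 1)) = a + 1 by omega,
      absDet_of_nonpos (h.det_nonneg (by omega) (by omega) (by omega))]

theorem hasTwoFarthest (h : IsVectorRealization w x y) (a : Fin w.length)
    (ha : 1 < (mset w (a + 1)).card) :
    HasTwoFarthest (fun a b : Fin w.length => absDet x y (a + 1) (b + 1)) a := by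
  obtain ⟨j, hj, k, hk, hjk⟩ := Finset.one_lt_card.1 ha
  have key : ∀ j ∈ mset w (a + 1), ∃ j' : Fin w.length, (j' : ℕ) + 1 = j ∧
      IsFarthest (fun a b : Fin w.length => absDet x y (a + 1) (b + 1)) a j' := by
    intro j hj
    simp only [mset, Finset.mem_filter, Finset.mem_Icc] at hj
    obtain ⟨⟨hj₁, hj₂⟩, hmax⟩ := hj
    obtain ⟨j, rfl⟩ : ∃ j', j = j' + 1 := ⟨j - 1, by omega⟩
    refine ⟨⟨j, hj₂⟩, rfl, fun l => ?_⟩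
    have := hmax (l + 1) ⟨by omega, l.2⟩
    rw [h.phi_eq_absDet, h.phi_eq_absDet a ⟨j, hj₂⟩] at this
    exact this
  obtain ⟨j', rfl, hj'⟩ := key j hj
  obtain ⟨k', rfl, hk'⟩ := key k hk
  exact ⟨j', k', fun e => hjk (by rw [e]), hj', hk'⟩

theorem hasTwoFarthest_or_of_denseSeq (h : IsVectorRealization w x y) (hd : DenseSeq w)
    (a : Fin w.length) :
    HasTwoFarthest (fun a b : Fin w.length => absDet x y (a + 1) (b + 1)) a ∨
      HasTwoFarthest (fun a b : Fin w.length => absDet x y (a + 1) (b + 1))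
        (cyclicSucc w.length a) := by
  have ha := a.2
  refine (hd (a + 1) (Finset.mem_Icc.2 ⟨by omega, ha⟩)).imp (h.hasTwoFarthest a) fun hs => ?_
  apply h.hasTwoFarthest
  convert hs using 3
  rw [val_cyclicSucc, addIdx]
  rcases Nat.lt_or_ge (a + 1) w.length with hlt | hge
  · rw [Nat.mod_eq_of_lt hlt, if_pos (by omega)]
  · rw [show (a : ℕ) + 1 = w.length by omega, Nat.mod_self, if_neg (by omega)]
    omega

end IsVectorRealization

theorem val_iterate_cyclicSucc {n : ℕ} (a : Fin n) (t : ℕ) :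
    ((cyclicSucc n)^[t] a : ℕ) = (a + t) % n := by
  induction t with
  | zero => exact (Nat.mod_eq_of_lt a.2).symm
  | succ t ih => rw [Function.iterate_succ_apply', val_cyclicSucc, ih, Nat.mod_add_mod, add_assoc]

theorem iterate_cyclicSucc_eq_self_iff {n : ℕ} (a : Fin n) (t : ℕ) :
    (cyclicSucc n)^[t] a = a ↔ n ∣ t := by
  rw [Fin.ext_iff, val_iterate_cyclicSucc, ← Nat.modEq_zero_iff_dvd]
  constructor
  · intro h
    have : (a : ℕ) + t ≡ a + 0 [MOD n] := by
      rw [Nat.ModEq, h, add_zero, Nat.mod_eq_of_lt a.2]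
    exact Nat.ModEq.add_left_cancel' _ this
  · intro h
    have := h.add_left (a : ℕ)
    rwa [add_zero, Nat.ModEq, Nat.mod_eq_of_lt a.2] at this

theorem eq_rotate_of_iterate_cyclicSucc {w l : List ℤ} (hlen : w.length = l.length)
    (a : Fin w.length)
    (hval : ∀ t (ht : t < l.length), w[(cyclicSucc w.length)^[t] a] = l[t]) :
    ∃ k, w = l.rotate k := by
  refine ⟨w.length - a, List.ext_getElem (by simp [hlen]) fun j hj _ => ?_⟩
  have ha := a.2
  rw [List.getElem_rotate, ← hval]
  simp only [Fin.getElem_fin, val_iterate_cyclicSucc, ← hlen, Nat.add_mod_mod]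
  congr 1
  rw [show (a : ℕ) + (j + (w.length - a)) = j + w.length by omega, Nat.add_mod_right,
    Nat.mod_eq_of_lt hj]

section

variable {w : List ℤ}

theorem IsTri.exists_rotate (h : IsTri (cyclicSucc w.length) fun a => w[a]) :
    ∃ k, w = [1, 1, 1].rotate k := by
  obtain ⟨a, hne, h₃, c₀, c₁, c₂⟩ := h
  have d₃ := (iterate_cyclicSucc_eq_self_iff a 3).1 h₃
  have d₁ : ¬ w.length ∣ 1 := mt (iterate_cyclicSucc_eq_self_iff a 1).2 hne
  have hn := (Nat.dvd_prime Nat.prime_three).1 d₃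
  refine eq_rotate_of_iterate_cyclicSucc (hn.resolve_left fun h => d₁ (by rw [h])) a ?_
  intro t ht
  match t, ht with
  | 0, _ => exact c₀
  | 1, _ => exact c₁
  | 2, _ => exact c₂

theorem IsQuad.exists_rotate (h : IsQuad (cyclicSucc w.length) fun a => w[a]) :
    ∃ k, w = [1, 2, 1, 2].rotate k := by
  obtain ⟨a, _, hne, rfl, h₄, c₀, c₂, c₁, c₃⟩ := h
  have d₄ := (iterate_cyclicSucc_eq_self_iff a 4).1 h₄
  have d₂ : ¬ w.length ∣ 2 := mt (iterate_cyclicSucc_eq_self_iff a 2).2 hne.symm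
  have hn : w.length = 4 := by
    generalize w.length = n at d₄ d₂
    have := Nat.le_of_dvd (by norm_num) d₄
    interval_cases n <;> omega
  refine eq_rotate_of_iterate_cyclicSucc hn a ?_
  intro t ht
  match t, ht with
  | 0, _ => exact c₀
  | 1, _ => exact c₁
  | 2, _ => exact c₂
  | 3, _ => exact c₃

theorem IsHexa.exists_rotate (h : IsHexa (cyclicSucc w.length) fun a => w[a]) :
    ∃ k, w = [1, 3, 1, 3, 1, 3].rotate k := by
  obtain ⟨a, _, _, hne, rfl, rfl, h₆, c₀, c₂, c₄, c₁, c₃, c₅⟩ := h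
  have d₆ := (iterate_cyclicSucc_eq_self_iff a 6).1 h₆
  have d₂ : ¬ w.length ∣ 2 := mt (iterate_cyclicSucc_eq_self_iff a 2).2 hne.symm
  have d₃ : ¬ w.length ∣ 3 := by
    intro hd
    have h₃ := (iterate_cyclicSucc_eq_self_iff a 3).2 hd
    simp only [Function.iterate_succ, Function.iterate_zero, Function.comp_apply, id] at h₃
    rw [h₃, c₀] at c₃
    norm_num at c₃
  have hn : w.length = 6 := by
    generalize w.length = n at d₆ d₂ d₃
    have := Nat.le_of_dvd (by norm_num) d₆
    interval_cases n <;> omega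
  refine eq_rotate_of_iterate_cyclicSucc hn a ?_
  intro t ht
  match t, ht with
  | 0, _ => exact c₀
  | 1, _ => exact c₁
  | 2, _ => exact c₂
  | 3, _ => exact c₃
  | 4, _ => exact c₄
  | 5, _ => exact c₅

theorem IsOcta.exists_rotate (h : IsOcta (cyclicSucc w.length) fun a => w[a]) :
    ∃ k, w = [1, 3, 1, 4, 1, 3, 1, 4].rotate k := by
  obtain ⟨a, _, _, _, hne, rfl, rfl, rfl, h₈, c₀, c₂, c₄, c₆, c₁, c₃, c₅, c₇⟩ := h
  have d₈ := (iterate_cyclicSucc_eq_self_iff a 8).1 h₈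
  have d₄ : ¬ w.length ∣ 4 := mt (iterate_cyclicSucc_eq_self_iff a 4).2 hne.symm
  have hn : w.length = 8 := by
    generalize w.length = n at d₈ d₄
    have := Nat.le_of_dvd (by norm_num) d₈
    interval_cases n <;> omega
  refine eq_rotate_of_iterate_cyclicSucc hn a ?_
  intro t ht
  match t, ht with
  | 0, _ => exact c₀
  | 1, _ => exact c₁
  | 2, _ => exact c₂
  | 3, _ => exact c₃
  | 4, _ => exact c₄
  | 5, _ => exact c₅
  | 6, _ => exact c₆
  | 7, _ => exact c₇

theorem IsDodeca.exists_rotate (h : IsDodeca (cyclicSucc w.length) fun a => w[a]) :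
    ∃ k, w = [1, 3, 1, 5, 1, 3, 1, 5, 1, 3, 1, 5].rotate k := by
  obtain ⟨a, _, _, _, _, _, hne, hne', rfl, rfl, rfl, rfl, rfl, h₁₂, c₀, c₂, c₄, c₆, c₈, c₁₀,
    c₁, c₃, c₅, c₇, c₉, c₁₁⟩ := h
  have d₁₂ := (iterate_cyclicSucc_eq_self_iff a 12).1 h₁₂
  have d₄ : ¬ w.length ∣ 4 := mt (iterate_cyclicSucc_eq_self_iff a 4).2 hne.symm
  have d₆ : ¬ w.length ∣ 6 := mt (iterate_cyclicSucc_eq_self_iff a 6).2 hne'.symm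
  have hn : w.length = 12 := by
    generalize w.length = n at d₁₂ d₄ d₆
    have := Nat.le_of_dvd (by norm_num) d₁₂
    interval_cases n <;> omega
  refine eq_rotate_of_iterate_cyclicSucc hn a ?_
  intro t ht
  match t, ht with
  | 0, _ => exact c₀
  | 1, _ => exact c₁
  | 2, _ => exact c₂
  | 3, _ => exact c₃
  | 4, _ => exact c₄
  | 5, _ => exact c₅
  | 6, _ => exact c₆
  | 7, _ => exact c₇
  | 8, _ => exact c₈
  | 9, _ => exact c₉
  | 10, _ => exact c₁₀
  | 11, _ => exact c₁₁

end

/-- The first column of a product of matrices `etaM a`, computed recursively. -/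
def etaColumn : List ℤ → ℤ × ℤ
  | [] => (1, 0)
  | a :: l => (a * (etaColumn l).1 - (etaColumn l).2, (etaColumn l).1)

theorem prod_etaM_column (l : List ℤ) : (l.map etaM).prod 0 0 = (etaColumn l).1 ∧
    (l.map etaM).prod 1 0 = (etaColumn l).2 := by
  induction l with
  | nil => simp [etaColumn]
  | cons a l ih =>
    simp [etaColumn, etaM, Matrix.mul_apply, ← ih.1, ← ih.2, Fin.sum_univ_two, sub_eq_add_neg]

/-- A form of `phi` suited to evaluation. -/
def phiEval (c : List ℤ) (i j : ℕ) : ℤ :=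
  if i < j then (etaColumn ((c.drop (i - 1)).take (j - i))).2
  else (etaColumn ((c.drop (j - 1)).take (i - j))).2

theorem phi_eq_phiEval (c : List ℤ) (i j : ℕ) : phi c i j = phiEval c i j := by
  unfold phi phiEval
  rcases lt_trichotomy i j with h | rfl | h
  · rw [if_neg h.ne, if_pos h, if_pos h, (prod_etaM_column _).2]
  · simp [etaColumn]
  · rw [if_neg h.ne', if_neg h.not_gt, if_neg h.not_gt, (prod_etaM_column _).2]

/-- `phiEval c i` attains its maximum at least twice. -/
def HasTwoMaxima (c : List ℤ) (i : ℕ) : Prop :=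
  ∃ j ∈ Finset.Icc 1 c.length, ∃ k ∈ Finset.Icc 1 c.length, j ≠ k ∧
    ∀ l ∈ Finset.Icc 1 c.length, phiEval c i l ≤ phiEval c i j ∧ phiEval c i l ≤ phiEval c i k

instance (c : List ℤ) (i : ℕ) : Decidable (HasTwoMaxima c i) := by
  unfold HasTwoMaxima
  infer_instance

theorem HasTwoMaxima.one_lt_card {c : List ℤ} {i : ℕ} (h : HasTwoMaxima c i) :
    1 < (mset c i).card := by
  obtain ⟨j, hj, k, hk, hjk, hmax⟩ := h
  refine Finset.one_lt_card.2 ⟨j, ?_, k, ?_, hjk⟩ <;>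
    simp only [mset, Finset.mem_filter, phi_eq_phiEval]
  · exact ⟨hj, fun l hl => (hmax l hl).1⟩
  · exact ⟨hk, fun l hl => (hmax l hl).2⟩

/-- A decidable sufficient condition for `DenseSeq`. -/
abbrev DenseEval (c : List ℤ) : Prop :=
  ∀ i ∈ Finset.Icc 1 c.length, HasTwoMaxima c i ∨ HasTwoMaxima c (addIdx c.length i 1)

theorem DenseEval.denseSeq {c : List ℤ} (h : DenseEval c) : DenseSeq c :=
  fun i hi => (h i hi).imp HasTwoMaxima.one_lt_card HasTwoMaxima.one_lt_card

theorem denseSeq_rotate_of_period {l : List ℤ} (p : ℕ) (hp : l.rotate p = l) (hpos : 0 < p)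
    (h : ∀ k < p, DenseEval (l.rotate k)) (k : ℕ) : DenseSeq (l.rotate k) := by
  induction k using Nat.strong_induction_on with
  | _ k ih =>
    rcases Nat.lt_or_ge k p with hlt | hge
    · exact (h k hlt).denseSeq
    · have := ih (k - p) (by omega)
      rwa [← hp, List.rotate_rotate, Nat.add_sub_cancel' hge] at this

set_option maxRecDepth 10000 in
theorem denseSeq_of_mem {l : List ℤ} (hl : l ∈ [([1, 1, 1] : List ℤ), [1, 2, 1, 2],
    [1, 3, 1, 3, 1, 3], [1, 3, 1, 4, 1, 3, 1, 4], [1, 3, 1, 5, 1, 3, 1, 5, 1, 3, 1, 5]]) (k : ℕ) :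
    DenseSeq (l.rotate k) := by
  simp only [List.mem_cons, List.not_mem_nil, or_false] at hl
  rcases hl with rfl | rfl | rfl | rfl | rfl
  · exact denseSeq_rotate_of_period 1 rfl (by norm_num) (by decide) k
  · exact denseSeq_rotate_of_period 2 rfl (by norm_num) (by decide) k
  · exact denseSeq_rotate_of_period 2 rfl (by norm_num) (by decide) k
  · exact denseSeq_rotate_of_period 4 rfl (by norm_num) (by decide) k
  · exact denseSeq_rotate_of_period 4 rfl (by norm_num) (by decide) k

theorem dense_classification (c : List ℤ) (h : IsEta c) :
    DenseSeq c ↔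
      ∃ s ∈ [([1, 1, 1] : List ℤ), [1, 2, 1, 2], [1, 3, 1, 3, 1, 3],
          [1, 3, 1, 4, 1, 3, 1, 4], [1, 3, 1, 5, 1, 3, 1, 5, 1, 3, 1, 5]],
        ∃ k, c = s.rotate k := by
  constructor
  · intro hd
    obtain ⟨x, y, hv⟩ := h.exists_vectorRealization
    have hn := hv.two_le
    have : Nonempty (Fin c.length) := ⟨⟨0, by omega⟩⟩
    rcases hv.friezeMetric.classification (hv.hasTwoFarthest_or_of_denseSeq hd) with
      h | h | h | h | h
    · exact ⟨_, by simp, h.exists_rotate⟩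
    · exact ⟨_, by simp, h.exists_rotate⟩
    · exact ⟨_, by simp, h.exists_rotate⟩
    · exact ⟨_, by simp, h.exists_rotate⟩
    · exact ⟨_, by simp, h.exists_rotate⟩
  · rintro ⟨s, hs, k, rfl⟩
    exact denseSeq_of_mem hs k
end

section
/- Let c = (c₁,…,cₙ) ∈ 𝒜⁺ with n ≥ 3. Then there exists i ∈ {1,…,n} such that the finite set R := { (φ_i(j), φ_{i⊕1}(j)) : j ∈ {1,…,n} } ⊆ ℤ² (where i⊕1 denotes i+1, with n⊕1 := 1) has a unique maximal element with respect to the componentwise partial order ((a,b) ≤ (c,d) iff a ≤ c and b ≤ d). Moreover, if c is not dense, then i can be chosen such that the unique maximal element (x,y) of R satisfies x > u and y > v for every (u,v) ∈ R with (u,v) ≠ (x,y). -/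
open Matrix Finset

/-- The set of positive roots at the chamber `(i, i+1)`. -/
def rootSet (c : List ℤ) (i : ℕ) : Finset (ℤ × ℤ) :=
  (Finset.Icc 1 c.length).image (fun j => (phi c i j, phi c (addIdx c.length i 1) j))

/-- Elimination of the coordinates arising in `IsFrieze.single_step`. -/
theorem coordinate_cases {M b A e s t s' t' : ℤ} (hs : 1 ≤ s) (ht : 1 ≤ t) (hs' : 1 ≤ s')
    (ht' : 1 ≤ t') (he : 0 ≤ e) (hb : e < b) (hA : e < A) (hdet : A * b - M * e = 1)
    (hzw : s * t' * (b - e) ≤ s + t') (hwz : t * s' * (A - e) ≤ t + s') (hvw : s * b ≤ M) :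
    (s = 1 ∧ t' = 1 ∧ b = e + 2) ∨ (t = 1 ∧ s' = 1 ∧ M = 5 ∧ b = 2 ∧ A = 3 ∧ e = 1) ∨ e = 0 ∨
      (s = 1 ∧ M = b + 1 ∧ 2 ≤ b) := by
  have small : ∀ {x y g : ℤ}, 1 ≤ x → 1 ≤ y → 1 ≤ g → x * y * g ≤ x + y →
      g = 1 ∨ (g = 2 ∧ x = 1 ∧ y = 1) := by
    intro x y g hx hy hg h
    have h₁ : x + y ≤ x * y + 1 := by nlinarith
    have h₂ : 1 ≤ x * y := by nlinarith
    rcases (show 1 ≤ g from hg).eq_or_lt with rfl | hg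
    · exact Or.inl rfl
    have h₄ : x * y ≤ 1 := by nlinarith
    have h₅ : g = 2 := by nlinarith
    exact Or.inr ⟨h₅, by nlinarith, by nlinarith⟩
  rcases small hs ht' (by omega) hzw with hg | ⟨hg, h₁, h₂⟩
  · rcases he.eq_or_lt with rfl | he
    · exact Or.inr (Or.inr (Or.inl rfl))
    obtain rfl : b = e + 1 := by omega
    rcases small ht hs' (by omega) hwz with hg' | ⟨hg', h₁, h₂⟩
    · obtain rfl : A = e + 1 := by omega
      have hM : M = e + 2 := by
        have : e * (M - (e + 2)) = 0 := by linear_combination -hdet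
        rcases mul_eq_zero.mp this with h | h <;> omega
      refine Or.inr (Or.inr (Or.inr ⟨?_, by omega, by omega⟩))
      subst hM
      nlinarith
    · obtain rfl : A = e + 2 := by omega
      have h : e * (M - (e + 3)) = 1 := by linear_combination -hdet
      have he₁ : e = 1 := Int.eq_one_of_dvd_one he.le ⟨_, h.symm⟩
      subst he₁
      exact Or.inr (Or.inl ⟨h₁, h₂, by omega, by norm_num, by norm_num, rfl⟩)
  · exact Or.inl ⟨h₁, h₂, by omega⟩

/-- The determinants `D i j = det (p i, p j)` of an `n`-antiperiodic sequence of vectors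
`p : ℤ → ℤ²` whose consecutive members have determinant one and whose determinants within one
period are positive, axiomatised through the Plücker relations. -/
structure IsFrieze (n : ℤ) (D : ℤ → ℤ → ℤ) : Prop where
  plucker : ∀ i j k l, D i j * D k l - D i k * D j l + D i l * D j k = 0
  anti : ∀ i j, D i j = -D j i
  antiperiodic : ∀ i j, D i (j + n) = -D i j
  one : ∀ i, D i (i + 1) = 1
  pos : ∀ i j, i < j → j < i + n → 0 < D i j

/-- `j` is a position in the period `(i, i + n)` at which the row `D i` is maximal. -/
def IsArgmax (n : ℤ) (D : ℤ → ℤ → ℤ) (i j : ℤ) : Prop :=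
  i < j ∧ j < i + n ∧ ∀ k, i < k → k < i + n → D i k ≤ D i j

/-- `j` is the only position in the period `(i, i + n)` at which the row `D i` is maximal. -/
def IsUniqueArgmax (n : ℤ) (D : ℤ → ℤ → ℤ) (i j : ℤ) : Prop :=
  IsArgmax n D i j ∧ ∀ k, IsArgmax n D i k → k = j

namespace IsFrieze

variable {n : ℤ} {D : ℤ → ℤ → ℤ}

theorem self (F : IsFrieze n D) (i : ℤ) : D i i = 0 := by
  have := F.anti i i
  omega

theorem wrap (F : IsFrieze n D) (i j : ℤ) : D j (i + n) = D i j := by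
  rw [F.antiperiodic, F.anti i j]

theorem shift (F : IsFrieze n D) (i j : ℤ) : D (i + n) (j + n) = D i j := by
  rw [F.antiperiodic, F.anti, F.antiperiodic, F.anti j i]
  ring

theorem nonneg (F : IsFrieze n D) {i j : ℤ} (h₁ : i ≤ j) (h₂ : j ≤ i + n) : 0 ≤ D i j := by
  rcases h₁.eq_or_lt with rfl | h₁
  · exact (F.self i).ge
  rcases h₂.eq_or_lt with rfl | h₂
  · rw [F.antiperiodic, F.self, neg_zero]
  · exact (F.pos i j h₁ h₂).le

/-- Expansion of `D j k` in the basis given by the rows `i` and `i + 1`. -/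
theorem expand (F : IsFrieze n D) (i j k : ℤ) :
    D j k = D i j * D (i + 1) k - D i k * D (i + 1) j := by
  have := F.plucker i (i + 1) j k
  rw [F.one] at this
  linarith

/-- The linear recurrence satisfied by the columns. -/
theorem recurrence (F : IsFrieze n D) (i j : ℤ) :
    D j (i - 1) + D j (i + 1) = D (i - 1) (i + 1) * D j i := by
  have h₁ := F.plucker j (i - 1) i (i + 1)
  have h₂ := F.one i
  have h₃ := F.one (i - 1)
  rw [sub_add_cancel] at h₃
  rw [h₂, h₃] at h₁
  linarith

theorem exists_argmax (D : ℤ → ℤ → ℤ) (hn : 2 ≤ n) (i : ℤ) : ∃ j, IsArgmax n D i j := by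
  have hne : (Finset.Ioo i (i + n)).Nonempty := ⟨i + 1, by simp; omega⟩
  obtain ⟨j, hj, hmax⟩ := Finset.exists_max_image _ (D i) hne
  simp only [Finset.mem_Ioo] at hj hmax
  exact ⟨j, hj.1, hj.2, fun k h₁ h₂ => hmax k ⟨h₁, h₂⟩⟩

theorem abs_congr (F : IsFrieze n D) {i i' j j' : ℤ} (hi : i ≡ i' [ZMOD n])
    (hj : j ≡ j' [ZMOD n]) : |D i j| = |D i' j'| := by
  have key : ∀ i j q : ℤ, |D i (j + n * q)| = |D i j| := by
    intro i j q
    induction q using Int.induction_on with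
    | zero => simp
    | succ q ih =>
      have : j + n * (q + 1) = j + n * q + n := by ring
      rw [this, F.antiperiodic, abs_neg, ih]
    | pred q ih =>
      have : j + n * -q = j + n * (-q - 1) + n := by ring
      rw [← ih, this, F.antiperiodic, abs_neg]
  obtain ⟨p, rfl⟩ := Int.modEq_iff_add_fac.mp hi
  obtain ⟨q, rfl⟩ := Int.modEq_iff_add_fac.mp hj
  rw [key, F.anti (i + n * p), abs_neg, key, F.anti, abs_neg]

/-- Every position is congruent to one of the period `[i, i + n)`. -/
theorem exists_rep (hn : 0 < n) (i l : ℤ) : ∃ k, l ≡ k [ZMOD n] ∧ i ≤ k ∧ k < i + n := by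
  have h₁ := Int.emod_nonneg (l - i) hn.ne'
  have h₂ := Int.emod_lt_of_pos (l - i) hn
  refine ⟨i + (l - i) % n, ?_, by omega, by omega⟩
  have := (Int.ModEq.refl i).add (Int.mod_modEq (l - i) n).symm
  rwa [add_sub_cancel] at this

theorem abs_le (F : IsFrieze n D) {i j : ℤ} (h : IsArgmax n D i j) (l : ℤ) :
    |D i l| ≤ D i j := by
  obtain ⟨k, hlk, hik, hki⟩ := exists_rep (by linarith [h.1, h.2.1] : 0 < n) i l
  rw [F.abs_congr rfl hlk, abs_of_nonneg (F.nonneg hik hki.le)]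
  rcases hik.eq_or_lt with rfl | hik
  · rw [F.self]
    exact (F.pos _ _ h.1 h.2.1).le
  · exact h.2.2 k hik hki

theorem abs_lt (F : IsFrieze n D) {i j l : ℤ} (h : IsUniqueArgmax n D i j)
    (hl : ¬ l ≡ j [ZMOD n]) : |D i l| < D i j := by
  refine lt_of_le_of_ne (F.abs_le h.1 l) fun heq => hl ?_
  obtain ⟨k, hlk, hik, hki⟩ := exists_rep (by linarith [h.1.1, h.1.2.1] : 0 < n) i l
  rw [F.abs_congr rfl hlk, abs_of_nonneg (F.nonneg hik hki.le)] at heq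
  have hpos := F.pos _ _ h.1.1 h.1.2.1
  rcases hik.eq_or_lt with rfl | hik
  · rw [F.self] at heq
    omega
  · rwa [← h.2 k ⟨hik, hki, fun m h₁ h₂ => heq ▸ h.1.2.2 m h₁ h₂⟩]

theorem argmax_shift (F : IsFrieze n D) {i j : ℤ} (h : IsArgmax n D i j) :
    IsArgmax n D (i + n) (j + n) := by
  refine ⟨by linarith [h.1], by linarith [h.2.1], fun k h₁ h₂ => ?_⟩
  have := h.2.2 (k - n) (by linarith) (by linarith)
  rw [F.shift]
  rwa [← F.shift, sub_add_cancel] at this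

theorem argmax_shift_neg (F : IsFrieze n D) {i j : ℤ} (h : IsArgmax n D i j) :
    IsArgmax n D (i - n) (j - n) := by
  refine ⟨by linarith [h.1], by linarith [h.2.1], fun k h₁ h₂ => ?_⟩
  have := h.2.2 (k + n) (by linarith) (by linarith)
  rw [← F.shift, ← F.shift (i - n) (j - n)]
  simpa using this

theorem uniqueArgmax_shift (F : IsFrieze n D) {i j : ℤ} (h : IsUniqueArgmax n D i j) :
    IsUniqueArgmax n D (i + n) (j + n) := by
  refine ⟨F.argmax_shift h.1, fun k hk => ?_⟩
  have := F.argmax_shift_neg hk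
  rw [add_sub_cancel_right] at this
  linarith [h.2 _ this]

theorem uniqueArgmax_shift_nat (F : IsFrieze n D) {i j : ℤ} (h : IsUniqueArgmax n D i j) (q : ℕ) :
    IsUniqueArgmax n D (i + q * n) (j + q * n) := by
  induction q with
  | zero => simpa using h
  | succ q ih =>
    have := F.uniqueArgmax_shift ih
    push_cast
    rwa [add_assoc, add_assoc, ← add_one_mul] at this

theorem argmax_mono_succ (F : IsFrieze n D) {i j k : ℤ} (hj : IsArgmax n D i j)
    (hk : IsArgmax n D (i + 1) k) : j ≤ k := by
  obtain ⟨j₁, j₂, hj⟩ := hj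
  obtain ⟨k₁, k₂, hk⟩ := hk
  by_contra! hkj
  have h₁ := F.expand i k j
  have h₂ := F.pos k j hkj (by omega)
  have h₃ := hj k (by omega) (by omega)
  have h₄ := hk j (by omega) (by omega)
  have h₅ := F.pos i k (by omega) (by omega)
  have h₆ := F.pos (i + 1) j (by omega) (by omega)
  nlinarith

/-- The positions of the row maxima move monotonically. -/
theorem argmax_mono (F : IsFrieze n D) (hn : 2 ≤ n) {i i' j k : ℤ} (h : i < i')
    (hj : IsArgmax n D i j) (hk : IsArgmax n D i' k) : j ≤ k := by
  induction i', h using Int.leInduction generalizing k with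
  | base => exact F.argmax_mono_succ hj hk
  | succ m _ ih =>
    obtain ⟨l, hl⟩ := exists_argmax D hn m
    exact (ih hl).trans (F.argmax_mono_succ hl hk)

theorem exists_global_max (F : IsFrieze n D) (hn : 2 ≤ n) :
    ∃ u v, u < v ∧ v < u + n ∧ ∀ i j, D i j ≤ D u v := by
  choose f hf using exists_argmax D hn
  obtain ⟨u, -, hu⟩ := Finset.exists_max_image (Finset.Ico 0 n) (fun i => D i (f i))
    ⟨0, by simp; omega⟩
  have row : ∀ i, D i (f i) ≤ D u (f u) := by
    intro i
    have h₁ := Int.emod_nonneg i (by omega : n ≠ 0)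
    have h₂ := Int.emod_lt_of_pos i (by omega : 0 < n)
    calc D i (f i) ≤ |D (i % n) (f i)| := by
          rw [← F.abs_congr (Int.mod_modEq i n).symm rfl]
          exact le_abs_self _
      _ ≤ D (i % n) (f (i % n)) := F.abs_le (hf _) _
      _ ≤ D u (f u) := hu (i % n) (by simp; omega)
  exact ⟨u, f u, (hf u).1, (hf u).2.1, fun i j =>
    (le_abs_self _).trans ((F.abs_le (hf i) j).trans (row i))⟩

/-- Next to a row attaining the global maximum, the row maxima share a position. -/
theorem argmax_succ_or (F : IsFrieze n D) {u v k : ℤ}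
    (huv : u + 1 < v) (hvu : v < u + n) (hmax : ∀ i j, D i j ≤ D u v)
    (hk : IsArgmax n D (u + 1) k) : D (u + 1) v = D (u + 1) k ∨ D u k = D u v := by
  obtain ⟨k₁, k₂, hk⟩ := hk
  by_contra! hne
  have h₁ := F.expand u v k
  have h₂ := hmax v k
  have h₃ := lt_of_le_of_ne (hk v huv (by omega)) hne.1
  have h₄ := lt_of_le_of_ne (hmax u k) hne.2
  have h₅ := F.nonneg (i := u) (j := k) (by omega) (by omega)
  have h₆ := F.pos (u + 1) v huv (by omega)
  nlinarith

theorem argmax_pred_or (F : IsFrieze n D) {u v k : ℤ}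
    (huv : u < v) (hvu : v < u - 1 + n) (hmax : ∀ i j, D i j ≤ D u v)
    (hk : IsArgmax n D (u - 1) k) : D (u - 1) v = D (u - 1) k ∨ D u k = D u v := by
  obtain ⟨k₁, k₂, hk⟩ := hk
  by_contra! hne
  have h₁ := F.expand (u - 1) k v
  rw [sub_add_cancel] at h₁
  have h₂ := hmax k v
  have h₃ := lt_of_le_of_ne (hk v (by omega) hvu) hne.1
  have h₄ := lt_of_le_of_ne (hmax u k) hne.2
  have h₅ := F.nonneg (i := u) (j := k) (by omega) (by omega)
  have h₆ := F.pos (u - 1) v (by omega) (by omega)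
  nlinarith

theorem exists_common_argmax (F : IsFrieze n D) (hn : 3 ≤ n) :
    ∃ i j, IsArgmax n D i j ∧ IsArgmax n D (i + 1) j := by
  obtain ⟨u, v, huv, hvu, hmax⟩ := F.exists_global_max (by omega)
  have hu : ∀ j, u < j → j < u + n → D u j = D u v → IsArgmax n D u j :=
    fun j h₁ h₂ h => ⟨h₁, h₂, fun k _ _ => h ▸ hmax u k⟩
  rcases (show u + 1 ≤ v by omega).eq_or_lt with rfl | huv
  · have h₁ : ∀ i j, i < j → j < i + n → D i j = 1 := fun i j h₁ h₂ =>
      le_antisymm ((hmax i j).trans (F.one u).le) (F.pos i j h₁ h₂)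
    have h₂ : ∀ i j, i < j → j < i + n → IsArgmax n D i j := fun i j h h' =>
      ⟨h, h', fun k hk hk' => by rw [h₁ i j h h', h₁ i k hk hk']⟩
    exact ⟨u, u + 2, h₂ _ _ (by omega) (by omega), h₂ _ _ (by omega) (by omega)⟩
  · obtain ⟨k, hk⟩ := exists_argmax (n := n) D (by omega) (u + 1)
    rcases F.argmax_succ_or huv hvu hmax hk with h | h
    · exact ⟨u, v, hu v (by omega) hvu rfl, huv, by omega, fun l h₁ h₂ => h ▸ hk.2.2 l h₁ h₂⟩
    · refine ⟨u, k, hu k (by linarith [hk.1]) ?_ h, hk⟩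
      by_contra! hku
      have : k = u + n := by linarith [hk.2.1]
      rw [this, F.antiperiodic, F.self] at h
      linarith [F.pos u v (by omega) hvu]

/-- No two cyclically adjacent rows have the same unique argmax. -/
def NoSharedArgmax (n : ℤ) (D : ℤ → ℤ → ℤ) : Prop :=
  ∀ i j, IsUniqueArgmax n D i j → ¬ IsUniqueArgmax n D (i + 1) j

theorem isArgmax_of_global (F : IsFrieze n D) {u v : ℤ} (huv : u < v) (hvu : v < u + n)
    (hmax : ∀ i j, D i j ≤ D u v) {j : ℤ} (h₁ : u ≤ j) (h₂ : j ≤ u + n) (h : D u j = D u v) :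
    IsArgmax n D u j := by
  have hpos := F.pos u v huv hvu
  refine ⟨lt_of_le_of_ne h₁ ?_, lt_of_le_of_ne h₂ ?_, fun k _ _ => h ▸ hmax u k⟩
  · rintro rfl
    rw [F.self] at h
    omega
  · rintro rfl
    rw [F.antiperiodic, F.self] at h
    omega

/-- If a row attains the global maximum `D u v = D u w` twice, the row `v = u + 2` does too. -/
theorem double_step (F : IsFrieze n D) (hn : 2 ≤ n) (hns : NoSharedArgmax n D) {u v w : ℤ}
    (huv : u + 1 < v) (hvw : v < w) (hwu : w < u + n) (hmax : ∀ i j, D i j ≤ D u v)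
    (h : D u w = D u v) :
    v = u + 2 ∧ D v w = D u v ∧ D v (u + n) = D u v := by
  have hv : D v (u + n) = D u v := F.wrap u v
  have hw : D v w = D u v := by
    have h₁ := F.expand u v w
    rw [h, ← mul_sub] at h₁
    have h₂ := F.pos v w hvw (by omega)
    have h₃ := hmax v w
    have h₄ := F.pos u v (by omega) (by omega)
    have h₅ : 0 < D (u + 1) w - D (u + 1) v := by
      by_contra! h
      nlinarith
    nlinarith
  have hargu : IsArgmax n D u w := F.isArgmax_of_global (by omega) (by omega) hmax
    (by omega) (by omega) h
  have hargv : IsArgmax n D v w := ⟨hvw, by omega, fun k _ _ => hw ▸ hmax v k⟩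
  have huniq : ∀ l, u < l → l < v → IsUniqueArgmax n D l w := by
    intro l h₁ h₂
    have key : ∀ k, IsArgmax n D l k → k = w := fun k hk =>
      le_antisymm (F.argmax_mono hn h₂ hk hargv) (F.argmax_mono hn h₁ hargu hk)
    obtain ⟨k, hk⟩ := exists_argmax D hn l
    exact ⟨key k hk ▸ hk, key⟩
  refine ⟨?_, hw, hv⟩
  by_contra hne
  exact hns _ _ (huniq (u + 1) (by omega) huv) (huniq (u + 1 + 1) (by omega) (by omega))

/-- Local structure around a global maximum `D u v` when global maxima are unique in their row. -/
theorem exists_argmax_neighbours (F : IsFrieze n D) (hn : 3 ≤ n) (hns : NoSharedArgmax n D)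
    {u v : ℤ} (huv : u < v) (hvu : v < u + n) (hmax : ∀ i j, D i j ≤ D u v) (hM : 1 < D u v)
    (hsingle : ∀ i j k, i < j → j < k → k < i + n → D i j = D u v → D i k ≠ D u v) :
    u + 1 < v ∧ v < u - 1 + n ∧ D (u - 1) (u + 1) = 1 ∧
    (∃ w, v < w ∧ w < u + n ∧ D (u + 1) w = D (u + 1) v) ∧
    (∃ z, u < z ∧ z < v ∧ D (u - 1) z = D (u - 1) v) ∧
    IsArgmax n D (u + 1) v := by
  have hv₁ : u + 1 < v := by
    refine lt_of_le_of_ne huv ?_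
    rintro rfl
    exact hM.ne' (F.one u)
  have hv₂ : v < u - 1 + n := by
    refine lt_of_le_of_ne (by omega) ?_
    rintro rfl
    rw [← F.wrap] at hM
    have := F.one (u - 1 + n)
    rw [show u - 1 + n + 1 = u + n by ring] at this
    omega
  have huq : IsUniqueArgmax n D u v := by
    refine ⟨⟨huv, hvu, fun k _ _ => hmax u k⟩, fun k hk => ?_⟩
    have h₁ : D u k = D u v := le_antisymm (hmax u k) (hk.2.2 v huv hvu)
    rcases lt_trichotomy k v with h | h | h
    · exact absurd rfl (hsingle u k v hk.1 h hvu h₁)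
    · exact h
    · exact absurd h₁ (hsingle u v k huv h hk.2.1 rfl)
  have hw : IsArgmax n D (u + 1) v := by
    obtain ⟨k, hk⟩ := exists_argmax (n := n) D (by omega) (u + 1)
    rcases F.argmax_succ_or hv₁ hvu hmax hk with h | h
    · exact ⟨hv₁, by omega, fun l h₁ h₂ => h ▸ hk.2.2 l h₁ h₂⟩
    · have := huq.2 k (F.isArgmax_of_global huv hvu hmax (by linarith [hk.1])
        (by linarith [hk.2.1]) h)
      exact this ▸ hk
  have hz : IsArgmax n D (u - 1) v := by
    obtain ⟨k, hk⟩ := exists_argmax (n := n) D (by omega) (u - 1)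
    rcases F.argmax_pred_or huv hv₂ hmax hk with h | h
    · exact ⟨by omega, hv₂, fun l h₁ h₂ => h ▸ hk.2.2 l h₁ h₂⟩
    · have := huq.2 k (F.isArgmax_of_global huv hvu hmax (by linarith [hk.1])
        (by linarith [hk.2.1]) h)
      exact this ▸ hk
  have hw' : ∃ w, v < w ∧ w < u + n ∧ D (u + 1) w = D (u + 1) v := by
    have h₁ : ¬ ∀ k, IsArgmax n D (u + 1) k → k = v := fun h => hns u v huq ⟨hw, h⟩
    push Not at h₁
    obtain ⟨w, hw', hne⟩ := h₁
    have hvw : v < w := lt_of_le_of_ne (F.argmax_mono_succ huq.1 hw') hne.symm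
    have heq : D (u + 1) w = D (u + 1) v :=
      le_antisymm (hw.2.2 w hw'.1 hw'.2.1) (hw'.2.2 v hw.1 hw.2.1)
    rcases (show w ≤ u + n by linarith [hw'.2.1]).eq_or_lt with rfl | h
    · rw [F.wrap u (u + 1), F.one] at heq
      refine ⟨v + 1, by omega, by omega, le_antisymm (hw.2.2 _ (by omega) (by omega)) ?_⟩
      rw [← heq]
      exact F.pos _ _ (by omega) (by omega)
    · exact ⟨w, hvw, h, heq⟩
  have hz' : ∃ z, u < z ∧ z < v ∧ D (u - 1) z = D (u - 1) v := by
    have h₁ : ¬ ∀ k, IsArgmax n D (u - 1) k → k = v := fun h =>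
      hns (u - 1) v ⟨hz, h⟩ (by rwa [sub_add_cancel])
    push Not at h₁
    obtain ⟨z, hz', hne⟩ := h₁
    have hvz : z < v := by
      refine lt_of_le_of_ne (F.argmax_mono_succ hz' ?_) hne
      rw [sub_add_cancel]
      exact huq.1
    have heq : D (u - 1) z = D (u - 1) v :=
      le_antisymm (hz.2.2 z hz'.1 hz'.2.1) (hz'.2.2 v hz.1 hz.2.1)
    rcases (show u ≤ z by linarith [hz'.1]).eq_or_lt with rfl | h
    · have := F.one (u - 1)
      rw [sub_add_cancel] at this
      rw [this] at heq
      refine ⟨v - 1, by omega, by omega, le_antisymm (hz.2.2 _ (by omega) (by omega)) ?_⟩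
      rw [← heq]
      exact F.pos _ _ (by omega) (by omega)
    · exact ⟨z, h, hvz, heq⟩
  refine ⟨hv₁, hv₂, ?_, hw', hz', hw⟩
  have h₁ := F.recurrence u v
  obtain ⟨w, hvw, hwu, heqw⟩ := hw'
  obtain ⟨z, hzu, hzv, heqz⟩ := hz'
  have h₂ : D (u + 1) v ≠ D u v := fun h =>
    hsingle (u + 1) v w hv₁ hvw (by omega) h (heqw.trans h)
  have h₃ : D (u - 1) v ≠ D u v := fun h =>
    hsingle (u - 1) z v (by omega) hzv hv₂ (heqz.trans h) h
  have h₄ := lt_of_le_of_ne (hmax _ _) h₂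
  have h₅ := lt_of_le_of_ne (hmax _ _) h₃
  have h₆ := F.pos (u + 1) v hv₁ (by omega)
  have h₇ := F.pos (u - 1) v (by omega) hv₂
  rw [F.anti v (u - 1), F.anti v (u + 1), F.anti v u] at h₁
  have h₈ : D (u - 1) v + D (u + 1) v = D (u - 1) (u + 1) * D u v := by linarith
  have h₉ : 0 < D (u - 1) (u + 1) := F.pos _ _ (by omega) (by omega)
  by_contra hne
  have : 2 ≤ D (u - 1) (u + 1) := by omega
  nlinarith

/-- If global maxima are unique in their row, the row `u + 2` attains the global maximum
whenever the row `u` does. -/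
theorem single_step (F : IsFrieze n D) (hn : 3 ≤ n) (hns : NoSharedArgmax n D)
    {u v : ℤ} (huv : u < v) (hvu : v < u + n) (hmax : ∀ i j, D i j ≤ D u v) (hM : 1 < D u v)
    (hsingle : ∀ i j k, i < j → j < k → k < i + n → D i j = D u v → D i k ≠ D u v) :
    ∃ v', u + 2 < v' ∧ v' < u + 2 + n ∧ D (u + 2) v' = D u v := by
  have hpv := F.wrap u v
  obtain ⟨hv₁, hv₂, hcu, ⟨w, hvw, hwu, hw⟩, ⟨z, huz, hzv, hz⟩, -⟩ :=
    F.exists_argmax_neighbours hn hns huv hvu hmax hM hsingle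
  obtain ⟨-, -, hcv, ⟨w₂, huw₂, hw₂v, hw₂⟩, ⟨w', hvw', hw'u, hw'⟩, -⟩ :=
    F.exists_argmax_neighbours hn hns hvu (show u + n < v + n by omega)
      (by rwa [hpv]) (by rwa [hpv]) (by rwa [hpv])
  obtain ⟨z', rfl⟩ : ∃ z', w₂ = z' + n := ⟨w₂ - n, by ring⟩
  rw [F.wrap, F.wrap] at hw₂
  rw [F.wrap] at hw'
  have finish : ∀ p q, u < p → p < v → v < q → q < u + n → D p q = D u v → D (u + 1) p = 1 →
      ∃ v', u + 2 < v' ∧ v' < u + 2 + n ∧ D (u + 2) v' = D u v := by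
    intro p q h₁ h₂ h₃ h₄ h₅ h₆
    obtain ⟨-, -, hc, -⟩ := F.exists_argmax_neighbours hn hns (show p < q by omega)
      (by omega) (by rwa [h₅]) (by rwa [h₅]) (by rwa [h₅])
    have h₇ := F.recurrence p (u + 1)
    rw [hc, h₆] at h₇
    have hp : p ≠ u + 1 := by
      rintro rfl
      rw [F.self] at h₆
      omega
    have h₈ := F.pos (u + 1) (p + 1) (by omega) (by omega)
    have hp' : p - 1 = u + 1 := by
      by_contra hne
      linarith [F.pos (u + 1) (p - 1) (by omega) (by omega)]
    obtain rfl : p = u + 2 := by omega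
    exact ⟨q, by omega, by omega, h₅⟩
  have hs : D u w ≠ D u v := hsingle u v w huv hvw hwu rfl
  have ht : D u z ≠ D u v := fun h => hsingle u z v huz hzv hvu h rfl
  have hs' : D v w' ≠ D u v := fun h => hsingle v w' (u + n) hvw' hw'u (by omega) h hpv
  have ht' : D z' v ≠ D u v := by
    rw [← F.wrap]
    exact hsingle v (u + n) (z' + n) hvu huw₂ hw₂v hpv
  replace hs := lt_of_le_of_ne (hmax _ _) hs
  replace ht := lt_of_le_of_ne (hmax _ _) ht
  replace hs' := lt_of_le_of_ne (hmax _ _) hs'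
  replace ht' := lt_of_le_of_ne (hmax _ _) ht'
  have hpred : ∀ j, D (u - 1) j = D u j - D (u + 1) j := by
    intro j
    have := F.recurrence u j
    rw [hcu, F.anti j (u - 1), F.anti j (u + 1), F.anti j u] at this
    linarith
  have hXf := F.recurrence v u
  have hYf := F.recurrence v (u + 1)
  rw [hcv, one_mul] at hXf hYf
  have hdet := F.one (v - 1)
  rw [sub_add_cancel, F.expand u] at hdet
  have hg := F.pos (u + 1) (v + 1) (by omega) (by omega)
  have hg' := F.pos (u - 1) (v - 1) (by omega) (by omega)
  have he := F.nonneg (i := u + 1) (j := v - 1) (by omega) (by omega)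
  have hvw_le := hmax v w
  have hzw_le := hmax z' w
  have hwz_le := hmax z w'
  have hww := F.one w
  have hzw_eq := F.expand u z' w
  have hwz_eq := F.expand u z w'
  have hvz := F.expand u z' v
  have hvw'_eq := F.expand u v w'
  rw [hpred] at hg'
  rw [hpred, hpred] at hz
  rw [F.expand u] at hw' hvw_le hww
  rw [F.expand u z' (v + 1)] at hw₂
  have he_zero : D (u + 1) (v - 1) = 0 → v = u + 2 := by
    intro h
    by_contra hne
    linarith [F.pos (u + 1) (v - 1) (by omega) (by omega)]
  have hfin₁ := finish z' w (by omega) (by omega) hvw hwu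
  have hfin₂ := finish z w' huz hzv hvw' hw'u
  generalize D u v = M at *
  generalize D (u + 1) v = b at *
  generalize D u (v - 1) = A at *
  generalize D (u + 1) (v - 1) = e at *
  obtain ⟨s, hXw⟩ : ∃ s, D u w = M - s := ⟨M - D u w, by ring⟩
  obtain ⟨t, hXz⟩ : ∃ t, D u z = M - t := ⟨M - D u z, by ring⟩
  obtain ⟨s', hvw's⟩ : ∃ s', D v w' = M - s' := ⟨M - D v w', by ring⟩
  obtain ⟨t', hvzt⟩ : ∃ t', D z' v = M - t' := ⟨M - D z' v, by ring⟩
  have hXf' : D u (v + 1) = M - A := by linarith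
  have hYf' : D (u + 1) (v + 1) = b - e := by linarith
  have hYz : D (u + 1) z = b - t := by linarith
  rw [hXf', hYf'] at hw₂
  rw [hvzt] at hvz
  rw [hvw's] at hvw'_eq
  have hXw' : D u w' = s' * A := by
    linear_combination (-D u w') * hdet + M * hw' + A * hvw'_eq
  have hYw' : D (u + 1) w' = s' * e + 1 := by
    linear_combination (1 - D (u + 1) w') * hdet + b * hw' + e * hvw'_eq
  have hXz' : D u z' = t' * (M - A) := by
    linear_combination (-D u z') * hdet + M * hw₂ + (M - A) * hvz
  have hYz' : D (u + 1) z' = t' * (b - e) - 1 := by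
    linear_combination (-1 - D (u + 1) z') * hdet + b * hw₂ + (b - e) * hvz
  rw [hXw, hw] at hvw_le
  have hzw_val : D z' w = M - (s + t') + s * t' * (b - e) := by
    rw [hzw_eq, hXz', hYz', hXw, hw]
    linear_combination (-t') * hdet
  have hwz_val : D z w' = M - (t + s') + t * s' * (A - e) := by
    rw [hwz_eq, hXz, hYz, hXw', hYw']
    linear_combination (-s') * hdet
  rcases coordinate_cases (M := M) (b := b) (A := A) (e := e) (s := s) (t := t) (s' := s')
    (t' := t') (by omega) (by omega) (by omega) (by omega) he (by omega) (by omega)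
    (by linarith) (by linarith) (by linarith) (by linarith) with
    ⟨rfl, rfl, rfl⟩ | ⟨rfl, rfl, rfl, rfl, rfl, rfl⟩ | rfl | ⟨rfl, rfl, hb⟩
  · exact hfin₁ (by rw [hzw_val]; ring) (by rw [hYz']; ring)
  · exact hfin₂ (by rw [hwz_val]; ring) (by rw [hYz]; ring)
  · obtain rfl := he_zero rfl
    exact ⟨u + n, hvu, by omega, hpv⟩
  · rw [hXw, hw] at hww
    have : b ∣ 1 := ⟨D (u + 1) (w + 1) - D u (w + 1), by linear_combination -hww⟩
    have := Int.le_of_dvd one_pos this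
    omega

/-- A frieze in which two adjacent rows have a unique argmax has two adjacent rows sharing it. -/
theorem exists_shared_unique_argmax (F : IsFrieze n D) (hn : 3 ≤ n) {i j k : ℤ}
    (hj : IsUniqueArgmax n D i j) (hk : IsUniqueArgmax n D (i + 1) k) :
    ∃ i j, IsUniqueArgmax n D i j ∧ IsUniqueArgmax n D (i + 1) j := by
  by_contra! hns
  replace hns : NoSharedArgmax n D := hns
  obtain ⟨u, v, huv, hvu, hmax⟩ := F.exists_global_max (by omega)
  have hM : 1 < D u v := by
    by_contra! hle
    have h₁ : ∀ a b, a < b → b < a + n → D a b = 1 := fun a b h h' =>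
      le_antisymm ((hmax a b).trans hle) (F.pos a b h h')
    have h₂ : ∀ a b, a < b → b < a + n → IsArgmax n D a b := fun a b h h' =>
      ⟨h, h', fun k hk hk' => by rw [h₁ a b h h', h₁ a k hk hk']⟩
    have h₃ := hj.2 (i + 1) (h₂ _ _ (by omega) (by omega))
    have h₄ := hj.2 (i + 2) (h₂ _ _ (by omega) (by omega))
    omega
  suffices h : ∃ u, ∀ q : ℕ, ∀ l, ¬ IsUniqueArgmax n D (u + 2 * q) l by
    obtain ⟨u, hu⟩ := h
    have hj' := F.uniqueArgmax_shift_nat hj (2 * (u - i).natAbs)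
    have hk' := F.uniqueArgmax_shift_nat hk (2 * (u - i).natAbs)
    push_cast at hj' hk'
    have hge : u ≤ i + 2 * |u - i| * n := by
      have h₁ := le_abs_self (u - i)
      have h₂ := abs_nonneg (u - i)
      nlinarith
    rw [add_right_comm] at hk'
    generalize i + 2 * |u - i| * n = r at *
    rcases Int.emod_two_eq_zero_or_one (r - u) with h | h
    · refine hu ((r - u) / 2).toNat (j + 2 * |u - i| * n) ?_
      convert hj' using 1
      omega
    · refine hu ((r + 1 - u) / 2).toNat (k + 2 * |u - i| * n) ?_
      convert hk' using 1
      omega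
  by_cases hsingle : ∀ i j k, i < j → j < k → k < i + n → D i j = D u v → D i k ≠ D u v
  · have hrow : ∀ q : ℕ, ∃ v', u + 2 * q < v' ∧ v' < u + 2 * q + n ∧
        D (u + 2 * q) v' = D u v := by
      intro q
      induction q with
      | zero => exact ⟨v, by simpa using huv, by simpa using hvu, by simp⟩
      | succ q ih =>
        obtain ⟨v', h₁, h₂, h₃⟩ := ih
        have := F.single_step hn hns h₁ h₂ (by rwa [h₃]) (by rwa [h₃]) (by rwa [h₃])
        rw [h₃] at this
        push_cast
        rwa [mul_add, mul_one, ← add_assoc]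
    refine ⟨u + 1, fun q l hl => ?_⟩
    obtain ⟨v', h₁, h₂, h₃⟩ := hrow q
    obtain ⟨-, -, -, ⟨w, h₄, h₅, h₆⟩, -, h₇⟩ := F.exists_argmax_neighbours hn hns h₁ h₂
      (by rwa [h₃]) (by rwa [h₃]) (by rwa [h₃])
    rw [add_right_comm] at hl
    have h₈ := hl.2 v' h₇
    have h₉ := hl.2 w ⟨by linarith [h₇.1], by omega, by rw [h₆]; exact h₇.2.2⟩
    omega
  · push Not at hsingle
    obtain ⟨u', v', w', h₁, h₂, h₃, h₄, h₅⟩ := hsingle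
    generalize D u v = M at *
    have hrow : ∀ q : ℕ, ∃ v w, u' + 2 * q < v ∧ v < w ∧ w < u' + 2 * q + n ∧
        D (u' + 2 * q) v = M ∧ D (u' + 2 * q) w = M := by
      intro q
      induction q with
      | zero =>
        exact ⟨v', w', by simpa using h₁, h₂, by simpa using h₃, by simpa using h₄,
          by simpa using h₅⟩
      | succ q ih =>
        obtain ⟨a, b, ha, hab, hb, hDa, hDb⟩ := ih
        have ha' : u' + 2 * q + 1 ≠ a := by
          rintro rfl
          rw [F.one] at hDa
          omega
        obtain ⟨rfl, h, h'⟩ := F.double_step (by omega) hns (by omega : u' + 2 * q + 1 < a) hab hb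
          (by rwa [hDa]) (by rw [hDa, hDb])
        refine ⟨b, u' + 2 * q + n, ?_, hb, ?_, ?_, ?_⟩ <;> push_cast <;>
          rw [mul_add, mul_one, ← add_assoc]
        · exact hab
        · omega
        · rw [h, hDa]
        · rw [h', hDa]
    refine ⟨u', fun q l hl => ?_⟩
    obtain ⟨a, b, ha, hab, hb, hDa, hDb⟩ := hrow q
    have h₆ := hl.2 a ⟨ha, by omega, fun k _ _ => hDa ▸ hmax _ k⟩
    have h₇ := hl.2 b ⟨by omega, hb, fun k _ _ => hDb ▸ hmax _ k⟩
    omega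

end IsFrieze

/-- The product `η(l₁)η(l₂)⋯` over a list. -/
def etaProd (l : List ℤ) : Matrix (Fin 2) (Fin 2) ℤ := (l.map etaM).prod

@[simp]
theorem etaProd_nil : etaProd [] = 1 := rfl

@[simp]
theorem etaProd_cons (a : ℤ) (l : List ℤ) : etaProd (a :: l) = etaM a * etaProd l := by
  simp [etaProd]

@[simp]
theorem etaProd_append (l l' : List ℤ) : etaProd (l ++ l') = etaProd l * etaProd l' := by
  simp [etaProd]

theorem etaM_mul_zero (a : ℤ) (X : Matrix (Fin 2) (Fin 2) ℤ) (j : Fin 2) :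
    (etaM a * X) 0 j = a * X 0 j - X 1 j := by
  simp [etaM, Matrix.mul_apply, Fin.sum_univ_two, sub_eq_add_neg]

theorem etaM_mul_one (a : ℤ) (X : Matrix (Fin 2) (Fin 2) ℤ) (j : Fin 2) :
    (etaM a * X) 1 j = X 0 j := by
  simp [etaM, Matrix.mul_apply, Fin.sum_univ_two]

theorem mul_etaM_zero (a : ℤ) (X : Matrix (Fin 2) (Fin 2) ℤ) (i : Fin 2) :
    (X * etaM a) i 0 = X i 0 * a + X i 1 := by
  simp [etaM, Matrix.mul_apply, Fin.sum_univ_two]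

theorem mul_etaM_one (a : ℤ) (X : Matrix (Fin 2) (Fin 2) ℤ) (i : Fin 2) :
    (X * etaM a) i 1 = -X i 0 := by
  simp [etaM, Matrix.mul_apply, Fin.sum_univ_two]

theorem det_etaProd (l : List ℤ) : (etaProd l).det = 1 := by
  induction l with
  | nil => simp
  | cons a l ih => rw [etaProd_cons, Matrix.det_mul, ih]; simp [etaM]

/-- Reversing a list transposes the product up to signs. -/
theorem etaProd_reverse (l : List ℤ) :
    etaProd l.reverse = !![etaProd l 0 0, -etaProd l 1 0; -etaProd l 0 1, etaProd l 1 1] := by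
  induction l with
  | nil => ext i j; fin_cases i <;> fin_cases j <;> simp
  | cons a l ih =>
    rw [List.reverse_cons, etaProd_append, ih, etaProd_cons, etaProd_cons, etaProd_nil, mul_one]
    ext i j
    fin_cases i <;> fin_cases j <;>
      simp [mul_etaM_zero, mul_etaM_one, etaM_mul_zero, etaM_mul_one] <;> ring

theorem etaProd_expand (a b : ℤ) (l : List ℤ) :
    etaProd ((a + 1) :: 1 :: (b + 1) :: l) = etaProd (a :: b :: l) := by
  ext i j
  fin_cases i <;> simp [etaM_mul_zero, etaM_mul_one] <;> ring

/-- The cyclic product is `-1`, and the continuants of all short slices are positive. -/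
theorem IsEta.prod_eq_and_pos {c : List ℤ} (h : IsEta c) : etaProd c = -1 ∧
    ∀ l, l <:+: c → l.length + 2 ≤ c.length → 0 < etaProd l 0 0 := by
  induction h with
  | base =>
    refine ⟨?_, fun l _ hl => ?_⟩
    · ext i j
      fin_cases i <;> fin_cases j <;> simp [etaM]
    · obtain rfl : l = [] := List.length_eq_zero_iff.mp (by simpa using hl)
      simp
  | @reverse c _ ih =>
    refine ⟨?_, fun l hl hlen => ?_⟩
    · rw [etaProd_reverse, ih.1]
      ext i j
      fin_cases i <;> fin_cases j <;> simp
    · have := ih.2 l.reverse (by rwa [← List.reverse_infix, List.reverse_reverse])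
        (by simpa using hlen)
      simpa [etaProd_reverse] using this
  | @rotate c _ ih =>
    match c with
    | [] => simpa using ih
    | a :: t =>
      obtain ⟨hprod, hpos⟩ := ih
      have hrot : etaProd t * etaM a = -1 := by
        have h₁ : etaM a * etaProd t = -1 := by simpa using hprod
        have h₂ : etaM a * -etaProd t = 1 := by rw [mul_neg, h₁, neg_neg]
        rw [← neg_neg (etaProd t * etaM a), ← neg_mul, mul_eq_one_comm.mp h₂]
      simp only [List.rotate_cons_succ, List.rotate_zero, List.length_append, List.length_cons,
        List.length_nil] at hpos ⊢
      refine ⟨by simpa using hrot, fun l hl hlen => ?_⟩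
      rcases List.infix_concat_iff.mp hl with hl | hl
      · rcases List.suffix_concat_iff.mp hl with rfl | ⟨l', rfl, m, rfl⟩
        · simp
        simp only [List.length_append, List.length_cons, List.length_nil] at hlen
        match m with
        | [] => simp at hlen
        | x :: m =>
          rcases List.eq_nil_or_concat m with rfl | ⟨m, y, rfl⟩
          · simp at hlen
            omega
          have hm := hpos m ⟨[a, x], [y] ++ l', by simp⟩ (by simp)
          have h₁ : etaProd (x :: (m ++ [y])) * etaProd (l' ++ [a]) = -1 := by
            simpa [mul_assoc] using hrot
          have h₂ := det_etaProd (l' ++ [a])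
          have h₃ : etaProd (x :: (m ++ [y])) 1 1 = -etaProd m 0 0 := by
            simp [etaM_mul_one, mul_etaM_one]
          have h₄ := congrFun (congrFun h₁ 1) 0
          have h₅ := congrFun (congrFun h₁ 1) 1
          rw [Matrix.det_fin_two] at h₂
          rw [Matrix.mul_apply, Fin.sum_univ_two, h₃] at h₄ h₅
          simp only [Matrix.neg_apply, Matrix.one_apply_eq,
            Matrix.one_apply_ne (one_ne_zero : (1 : Fin 2) ≠ 0), neg_zero] at h₄ h₅
          have : etaProd (l' ++ [a]) 0 0 = etaProd m 0 0 := by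
            linear_combination etaProd m 0 0 * h₂ - etaProd (l' ++ [a]) 0 1 * h₄ +
              etaProd (l' ++ [a]) 0 0 * h₅
          simpa [this] using hm
      · exact hpos l (hl.trans (List.suffix_cons a t).isInfix) (by omega)
  | @expand a b t _ ih =>
    obtain ⟨hprod, hpos⟩ := ih
    refine ⟨by rw [etaProd_expand, hprod], fun l hl hlen => ?_⟩
    simp only [List.length_cons] at hpos hlen
    have ha : 0 ≤ a ∧ (t ≠ [] → 0 < a) := by
      by_cases ht : t = []
      · subst ht
        have := congrFun (congrFun hprod 0) 1
        simp [etaM] at this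
        simp [this]
      · have := hpos [a] ⟨[], b :: t, by simp⟩ (by have := List.length_pos_iff.mpr ht; simp; omega)
        simp [etaM] at this
        exact ⟨this.le, fun _ => this⟩
    have hbt : etaProd (b :: t) 0 0 = 0 := by
      have := congrFun (congrFun hprod 1) 0
      simpa [etaM_mul_one] using this
    rcases List.infix_cons_iff.mp hl with hl₁ | hl₁
    · rcases List.prefix_cons_iff.mp hl₁ with rfl | ⟨l, rfl, hl₂⟩
      · simp
      rcases List.prefix_cons_iff.mp hl₂ with rfl | ⟨l, rfl, hl₃⟩
      · simp [etaM]; omega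
      rcases List.prefix_cons_iff.mp hl₃ with rfl | ⟨s, rfl, hs⟩
      · have := ha.2 (by rintro rfl; simp at hlen)
        simpa [etaM] using this
      rw [etaProd_expand]
      refine hpos _ ?_ (by simpa using hlen)
      obtain ⟨r, rfl⟩ := hs
      exact ⟨[], r, by simp⟩
    rcases List.infix_cons_iff.mp hl₁ with hl₂ | hl₂
    · rcases List.prefix_cons_iff.mp hl₂ with rfl | ⟨l, rfl, hl₃⟩
      · simp
      rcases List.prefix_cons_iff.mp hl₃ with rfl | ⟨s, rfl, hs⟩
      · simp [etaM]
      have h₁ : etaProd (1 :: (b + 1) :: s) 0 0 = etaProd (b :: s) 0 0 := by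
        simp [etaM_mul_zero, etaM_mul_one]
        ring
      rw [h₁]
      obtain ⟨r, rfl⟩ := hs
      exact hpos _ ⟨[a], r, by simp⟩ (by simpa using hlen)
    rcases List.infix_cons_iff.mp hl₂ with hl₃ | hl₃
    · rcases List.prefix_cons_iff.mp hl₃ with rfl | ⟨s, rfl, hs⟩
      · simp
      have h₁ : etaProd ((b + 1) :: s) 0 0 = etaProd (b :: s) 0 0 + etaProd s 0 0 := by
        simp [etaM_mul_zero]
        ring
      rw [h₁]
      have h₂ := hpos s (hs.isInfix.trans ⟨[a, b], [], by simp⟩) (by simpa using hs.length_le)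
      by_cases hst : s = t
      · rw [hst] at h₂ ⊢
        omega
      · have h₃ : s.length ≠ t.length := fun h => hst (hs.eq_of_length h)
        have h₄ := hs.length_le
        obtain ⟨r, rfl⟩ := hs
        have := hpos (b :: s) ⟨[a], r, by simp⟩ (by
          simp only [List.length_append, List.length_cons] at h₃ ⊢
          omega)
        omega
    · exact hpos l (hl₃.trans ⟨[a, b], [], by simp⟩) (by simpa using hl₃.length_le)

theorem etaProd_slice_pos {c l : List ℤ} (h : IsEta c) (hl : l <:+: c) (hne : l ≠ [])
    (hlen : l.length < c.length) : 0 < etaProd l 1 0 := by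
  match l with
  | a :: l =>
    rw [etaProd_cons, etaM_mul_one]
    exact h.prod_eq_and_pos.2 l ((List.suffix_cons a l).isInfix.trans hl) (by
      rw [List.length_cons] at hlen
      omega)

/-- The partial products of the cyclic extension of `c`, made antiperiodic. -/
def cyclicProd (c : List ℤ) (k : ℤ) : Matrix (Fin 2) (Fin 2) ℤ :=
  ((k / c.length).negOnePow : ℤ) • etaProd (c.take (k % c.length).toNat)

/-- The cyclic version of `phi`, given by the determinants of the first columns of the inverses
of the partial products. -/
def cyclicPhi (c : List ℤ) (i j : ℤ) : ℤ :=
  cyclicProd c i 0 0 * cyclicProd c j 1 0 - cyclicProd c i 1 0 * cyclicProd c j 0 0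

theorem cyclicProd_of_lt {c : List ℤ} {k : ℕ} (hk : k < c.length) :
    cyclicProd c k = etaProd (c.take k) := by
  have h₁ : (k : ℤ) / c.length = 0 := Int.ediv_eq_zero_of_lt (by omega) (by omega)
  have h₂ : (k : ℤ) % c.length = k := Int.emod_eq_of_lt (by omega) (by omega)
  simp [cyclicProd, h₁, h₂]

theorem cyclicProd_add_length {c : List ℤ} (hc : c ≠ []) (k : ℤ) :
    cyclicProd c (k + c.length) = -cyclicProd c k := by
  rw [cyclicProd, Int.add_ediv_of_dvd_right dvd_rfl, Int.ediv_self (by simpa using hc),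
    Int.add_emod_right, Int.negOnePow_succ, Units.val_neg, neg_smul, cyclicProd]

theorem cyclicPhi_add_length {c : List ℤ} (hc : c ≠ []) (i j : ℤ) :
    cyclicPhi c i (j + c.length) = -cyclicPhi c i j := by
  simp only [cyclicPhi, cyclicProd_add_length hc, Matrix.neg_apply]
  ring

theorem cyclicPhi_anti (c : List ℤ) (i j : ℤ) : cyclicPhi c i j = -cyclicPhi c j i := by
  simp only [cyclicPhi]
  ring

theorem cyclicPhi_shift {c : List ℤ} (hc : c ≠ []) (i j q : ℤ) :
    cyclicPhi c (i + c.length * q) (j + c.length * q) = cyclicPhi c i j := by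
  have step : ∀ i j, cyclicPhi c (i + c.length) (j + c.length) = cyclicPhi c i j := by
    intro i j
    rw [cyclicPhi_add_length hc, cyclicPhi_anti, cyclicPhi_add_length hc, cyclicPhi_anti c j i]
    ring
  induction q using Int.induction_on with
  | zero => simp
  | succ q ih => rw [← ih, ← step (i + c.length * q)]; congr 1 <;> ring
  | pred q ih => rw [← ih, ← step]; congr 1 <;> ring

theorem cyclicPhi_slice {c : List ℤ} {i j : ℕ} (hij : i ≤ j) (hj : j < c.length) :
    cyclicPhi c i j = etaProd ((c.drop i).take (j - i)) 1 0 := by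
  have hdet := det_etaProd (c.take i)
  have htake : c.take j = c.take i ++ (c.drop i).take (j - i) := by
    rw [← List.take_add, Nat.add_sub_cancel' hij]
  rw [cyclicPhi, cyclicProd_of_lt hj, cyclicProd_of_lt (hij.trans_lt hj), htake, etaProd_append,
    Matrix.mul_apply, Matrix.mul_apply, Fin.sum_univ_two, Fin.sum_univ_two]
  rw [Matrix.det_fin_two] at hdet
  linear_combination etaProd ((c.drop i).take (j - i)) 1 0 * hdet

theorem cyclicPhi_slice_pos {c : List ℤ} (h : IsEta c) {i j : ℕ} (hij : i < j)
    (hj : j < c.length) : 0 < cyclicPhi c i j := by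
  rw [cyclicPhi_slice hij.le hj]
  have hlen : ((c.drop i).take (j - i)).length = j - i := by simp; omega
  refine etaProd_slice_pos h
    ((List.take_prefix _ _).isInfix.trans (List.drop_suffix _ _).isInfix) ?_ (by omega)
  rw [← List.length_pos_iff]
  omega

theorem isFrieze_cyclicPhi {c : List ℤ} (h : IsEta c) (hn : 2 ≤ c.length) :
    IsFrieze c.length (cyclicPhi c) := by
  have hc : c ≠ [] := by
    rintro rfl
    simp at hn
  have reduce : ∀ i, ∃ r : ℕ, ∃ q : ℤ, r < c.length ∧ i = r + c.length * q := by
    intro i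
    have h₁ := Int.emod_nonneg i (by omega : (c.length : ℤ) ≠ 0)
    have h₂ := Int.emod_lt_of_pos i (by omega : 0 < (c.length : ℤ))
    have h₃ := Int.emod_add_mul_ediv i c.length
    exact ⟨(i % c.length).toNat, i / c.length, by omega, by rw [Int.toNat_of_nonneg h₁, h₃]⟩
  refine ⟨fun i j k l => ?_, cyclicPhi_anti c, cyclicPhi_add_length hc, fun i => ?_,
    fun i j hij hji => ?_⟩
  · simp only [cyclicPhi]
    ring
  · obtain ⟨r, q, hr, rfl⟩ := reduce i
    rw [add_right_comm, cyclicPhi_shift hc]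
    rcases (show r + 1 ≤ c.length from hr).lt_or_eq with hr' | hr'
    · have := cyclicPhi_slice (Nat.le_add_right r 1) hr'
      push_cast at this
      obtain ⟨a, ha⟩ := List.length_eq_one_iff.mp
        (show ((c.drop r).take (r + 1 - r)).length = 1 by simp; omega)
      rw [this, ha]
      simp [etaM]
    · have h₁ : (r : ℤ) + 1 = 0 + c.length := by omega
      have h₂ := cyclicPhi_slice (Nat.zero_le r) hr
      obtain ⟨a, ha⟩ : ∃ a, c.take r ++ [a] = c :=
        ⟨_, by rw [List.take_append_getElem hr, hr', List.take_length]⟩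
      have h₃ := h.prod_eq_and_pos.1
      rw [← ha, etaProd_append, etaProd_cons, etaProd_nil, mul_one] at h₃
      rw [h₁, cyclicPhi_add_length hc, cyclicPhi_anti, neg_neg]
      have h₄ := congrFun (congrFun h₃ 1) 1
      rw [mul_etaM_one] at h₄
      exact h₂.trans (neg_injective h₄)
  · obtain ⟨r, q, hr, rfl⟩ := reduce i
    obtain ⟨s, rfl⟩ : ∃ s : ℕ, j = s + c.length * q :=
      ⟨(j - c.length * q).toNat, by omega⟩
    rw [cyclicPhi_shift hc]
    by_cases hs : s < c.length
    · exact cyclicPhi_slice_pos h (by omega) hs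
    · obtain ⟨s, rfl⟩ := Nat.exists_eq_add_of_le' (not_lt.mp hs)
      push_cast
      rw [cyclicPhi_add_length hc, cyclicPhi_anti, neg_neg]
      exact cyclicPhi_slice_pos h (by push_cast at hji; omega) hr

theorem phi_comm (c : List ℤ) (i j : ℕ) : phi c i j = phi c j i := by
  rcases lt_trichotomy i j with h | rfl | h
  · simp [phi, h, h.ne, h.ne', h.le]
  · rfl
  · simp [phi, h, h.ne, h.ne', h.le]

/-- `phi` agrees with the absolute value of `cyclicPhi`. -/
theorem phi_eq {c : List ℤ} (h : IsEta c) (hn : 2 ≤ c.length) {i j : ℕ}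
    (hi : i ∈ Finset.Icc 1 c.length) (hj : j ∈ Finset.Icc 1 c.length) {I J : ℤ}
    (hI : (i : ℤ) ≡ I + 1 [ZMOD c.length]) (hJ : (j : ℤ) ≡ J + 1 [ZMOD c.length]) :
    phi c i j = |cyclicPhi c I J| := by
  have F := isFrieze_cyclicPhi h hn
  have key : ∀ a b : ℕ, a < b → b < c.length → phi c (a + 1) (b + 1) = |cyclicPhi c a b| := by
    intro a b hab hb
    rw [abs_of_pos (cyclicPhi_slice_pos h hab hb), cyclicPhi_slice hab.le hb]
    simp [phi, hab, hab.ne, etaProd]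
  simp only [Finset.mem_Icc] at hi hj
  obtain ⟨a, rfl⟩ := Nat.exists_eq_add_of_le' hi.1
  obtain ⟨b, rfl⟩ := Nat.exists_eq_add_of_le' hj.1
  push_cast at hI hJ
  rw [← F.abs_congr hI.add_right_cancel' hJ.add_right_cancel']
  rcases lt_trichotomy a b with hab | rfl | hab
  · exact key a b hab (by omega)
  · simp [phi, F.self]
  · rw [phi_comm, key b a hab (by omega), F.anti, abs_neg]

theorem exists_index {n : ℕ} (hn : 0 < n) (I : ℤ) :
    ∃ i ∈ Finset.Icc 1 n, (i : ℤ) ≡ I + 1 [ZMOD n] := by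
  obtain ⟨k, hk, h₁, h₂⟩ := IsFrieze.exists_rep (Nat.cast_pos.mpr hn) 1 (I + 1)
  refine ⟨k.toNat, by simp only [Finset.mem_Icc]; omega, ?_⟩
  rw [Int.toNat_of_nonneg (by omega)]
  exact hk.symm

theorem addIdx_mem {n i : ℕ} (hi : i ∈ Finset.Icc 1 n) : addIdx n i 1 ∈ Finset.Icc 1 n := by
  simp only [Finset.mem_Icc, addIdx] at hi ⊢
  split <;> omega

theorem addIdx_modEq {n i : ℕ} (hi : i ∈ Finset.Icc 1 n) :
    (addIdx n i 1 : ℤ) ≡ i + 1 [ZMOD n] := by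
  simp only [Finset.mem_Icc] at hi
  unfold addIdx
  split
  · simp
  · obtain rfl : i = n := by omega
    simp [Int.ModEq]

/-- If adjacent rows share an argmax, the corresponding chamber has a greatest root. -/
theorem exists_greatest_root {c : List ℤ} (h : IsEta c) (hn : 2 ≤ c.length) {I J : ℤ}
    (hJ : IsArgmax c.length (cyclicPhi c) I J) (hJ' : IsArgmax c.length (cyclicPhi c) (I + 1) J) :
    ∃ i ∈ Finset.Icc 1 c.length, ∃ p ∈ rootSet c i, (∀ q ∈ rootSet c i, q ≤ p) ∧
      (IsUniqueArgmax c.length (cyclicPhi c) I J →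
        IsUniqueArgmax c.length (cyclicPhi c) (I + 1) J →
        ∀ q ∈ rootSet c i, q ≠ p → q.1 < p.1 ∧ q.2 < p.2) := by
  have F := isFrieze_cyclicPhi h hn
  obtain ⟨i, hi, hiI⟩ := exists_index (by omega : 0 < c.length) I
  obtain ⟨j, hj, hjJ⟩ := exists_index (by omega : 0 < c.length) J
  have hi' := addIdx_mem hi
  have hiI' := (addIdx_modEq hi).trans (hiI.add_right 1)
  have hp : ∀ {l : ℕ} {L : ℤ}, l ∈ Finset.Icc 1 c.length → (l : ℤ) ≡ L + 1 [ZMOD c.length] →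
      (phi c i l, phi c (addIdx c.length i 1) l) = (|cyclicPhi c I L|, |cyclicPhi c (I + 1) L|) :=
    fun hl hlL => by rw [phi_eq h hn hi hl hiI hlL, phi_eq h hn hi' hl hiI' hlL]
  have hq : ∀ q ∈ rootSet c i, ∃ L : ℤ, q = (|cyclicPhi c I L|, |cyclicPhi c (I + 1) L|) := by
    intro q hq
    obtain ⟨l, hl, rfl⟩ := Finset.mem_image.mp hq
    exact ⟨l - 1, hp hl (by simp)⟩
  have hpos : |cyclicPhi c I J| = cyclicPhi c I J := abs_of_pos (F.pos _ _ hJ.1 hJ.2.1)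
  have hpos' : |cyclicPhi c (I + 1) J| = cyclicPhi c (I + 1) J :=
    abs_of_pos (F.pos _ _ hJ'.1 hJ'.2.1)
  refine ⟨i, hi, (cyclicPhi c I J, cyclicPhi c (I + 1) J),
    Finset.mem_image.mpr ⟨j, hj, by rw [hp hj hjJ, hpos, hpos']⟩, fun q hqi => ?_,
    fun hu hu' q hqi hne => ?_⟩
  · obtain ⟨L, rfl⟩ := hq q hqi
    exact ⟨F.abs_le hJ L, F.abs_le hJ' L⟩
  · obtain ⟨L, rfl⟩ := hq q hqi
    have hLJ : ¬ L ≡ J [ZMOD c.length] := fun hLJ =>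
      hne (by rw [F.abs_congr rfl hLJ, F.abs_congr rfl hLJ, hpos, hpos'])
    exact ⟨F.abs_lt hu hLJ, F.abs_lt hu' hLJ⟩

theorem exists_isUniqueArgmax {c : List ℤ} (h : IsEta c) (hn : 2 ≤ c.length) {i : ℕ}
    (hi : i ∈ Finset.Icc 1 c.length) {I : ℤ} (hI : (i : ℤ) ≡ I + 1 [ZMOD c.length])
    (hcard : (mset c i).card ≤ 1) : ∃ J, IsUniqueArgmax c.length (cyclicPhi c) I J := by
  have F := isFrieze_cyclicPhi h hn
  have hmem : ∀ {J : ℤ} {j : ℕ}, IsArgmax c.length (cyclicPhi c) I J → j ∈ Finset.Icc 1 c.length →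
      (j : ℤ) ≡ J + 1 [ZMOD c.length] → j ∈ mset c i := by
    intro J j hJ hj hjJ
    simp only [mset, Finset.mem_filter]
    refine ⟨hj, fun l hl => ?_⟩
    rw [phi_eq h hn hi hl hI (show (l : ℤ) ≡ (l - 1) + 1 [ZMOD c.length] by simp),
      phi_eq h hn hi hj hI hjJ, abs_of_pos (F.pos _ _ hJ.1 hJ.2.1)]
    exact F.abs_le hJ _
  obtain ⟨J, hJ⟩ := IsFrieze.exists_argmax (n := c.length) (cyclicPhi c) (by omega) I
  refine ⟨J, hJ, fun K hK => ?_⟩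
  obtain ⟨j, hj, hjJ⟩ := exists_index (by omega : 0 < c.length) J
  obtain ⟨k, hk, hkK⟩ := exists_index (by omega : 0 < c.length) K
  have hjk := Finset.card_le_one.mp hcard _ (hmem hJ hj hjJ) _ (hmem hK hk hkK)
  rw [← hjk] at hkK
  have hKJ := (hkK.symm.trans hjJ).add_right_cancel'
  refine sub_eq_zero.mp (Int.eq_zero_of_abs_lt_dvd hKJ.symm.dvd (abs_lt.mpr ⟨?_, ?_⟩)) <;>
    linarith [hJ.1, hJ.2.1, hK.1, hK.2.1]

theorem existsUnique_maximal_of_greatest {s : Finset (ℤ × ℤ)} {p : ℤ × ℤ} (hp : p ∈ s)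
    (hmax : ∀ q ∈ s, q ≤ p) : ∃! p : ℤ × ℤ, p ∈ s ∧ ∀ q ∈ s, p ≤ q → q = p :=
  ⟨p, ⟨hp, fun q hq h => le_antisymm (hmax q hq) h⟩, fun q hq => (hq.2 p hp (hmax q hq.1)).symm⟩

theorem exists_unique_maximal_root (c : List ℤ) (h : IsEta c) (hn : 3 ≤ c.length) :
    (∃ i ∈ Finset.Icc 1 c.length,
       ∃! p : ℤ × ℤ, p ∈ rootSet c i ∧ ∀ q ∈ rootSet c i, p ≤ q → q = p) ∧
    (¬ DenseSeq c → ∃ i ∈ Finset.Icc 1 c.length,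
       (∃! p : ℤ × ℤ, p ∈ rootSet c i ∧ ∀ q ∈ rootSet c i, p ≤ q → q = p) ∧
       ∃ p ∈ rootSet c i, ∀ q ∈ rootSet c i, q ≠ p → q.1 < p.1 ∧ q.2 < p.2) := by
  have hn₂ : 2 ≤ c.length := by omega
  have F := isFrieze_cyclicPhi h hn₂
  have hnZ : (3 : ℤ) ≤ c.length := by exact_mod_cast hn
  constructor
  · obtain ⟨I, J, hJ, hJ'⟩ := F.exists_common_argmax hnZ
    obtain ⟨i, hi, p, hp, hmax, -⟩ := exists_greatest_root h hn₂ hJ hJ'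
    exact ⟨i, hi, existsUnique_maximal_of_greatest hp hmax⟩
  · intro hdense
    simp only [DenseSeq, not_forall, not_or, not_lt] at hdense
    obtain ⟨i, hi, hcard, hcard'⟩ := hdense
    have hmod : (i : ℤ) ≡ (i - 1) + 1 [ZMOD c.length] := by simp
    obtain ⟨j, hj⟩ := exists_isUniqueArgmax h hn₂ hi hmod hcard
    obtain ⟨k, hk⟩ := exists_isUniqueArgmax h hn₂ (addIdx_mem hi)
      ((addIdx_modEq hi).trans (hmod.add_right 1)) hcard'
    obtain ⟨I, J, hJ, hJ'⟩ := F.exists_shared_unique_argmax hnZ hj hk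
    obtain ⟨i, hi, p, hp, hmax, hstrict⟩ := exists_greatest_root h hn₂ hJ.1 hJ'.1
    exact ⟨i, hi, existsUnique_maximal_of_greatest hp hmax, p, hp, hstrict hJ hJ'⟩
end

section
/- Let 𝒜'' := { (c₁,…,cₙ) ∈ 𝒜⁺ : n is even and c_i = 1 for all even i ∈ {1,…,n} }. Then the map ψ : 𝒜'' → 𝒜⁺ defined by ψ(c₁, 1, c₃, 1, …, c_{n−1}, 1) = (c₁−2, c₃−2, …, c_{n−1}−2) is a well-defined bijection from 𝒜'' onto 𝒜⁺. -/
open Matrix Finset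

/-- `ψ(c₁, 1, c₃, 1, …, c_{n-1}, 1) = (c₁ - 2, c₃ - 2, …, c_{n-1} - 2)`. -/
def psiMap : List ℤ → List ℤ
  | a :: _ :: t => (a - 2) :: psiMap t
  | _ => []

namespace IsEta

theorem isRotated {c d : List ℤ} (hc : IsEta c) (h : c ~r d) : IsEta d := by
  obtain ⟨n, rfl⟩ := h
  induction n with
  | zero => simpa using hc
  | succ n ih => simpa [List.rotate_rotate] using ih.rotate

theorem append_comm {u v : List ℤ} (h : IsEta (u ++ v)) : IsEta (v ++ u) :=
  h.isRotated List.isRotated_append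

theorem two_le_length {c : List ℤ} (h : IsEta c) : 2 ≤ c.length := by
  induction h <;> simp_all

theorem eq_zeros_or_pos {c : List ℤ} (h : IsEta c) : c = [0, 0] ∨ ∀ x ∈ c, 1 ≤ x := by
  induction h with
  | base => exact .inl rfl
  | rotate _ ih => exact ih.imp (by rintro rfl; rfl) (by simp [List.mem_rotate])
  | reverse _ ih => exact ih.imp (by rintro rfl; rfl) (by simp)
  | expand _ ih =>
    right
    rcases ih with h | h
    · simp_all
    · simp only [List.mem_cons, forall_eq_or_imp] at h ⊢
      exact ⟨by lia, le_rfl, by lia, h.2.2⟩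

theorem eq_zeros_of_zero_mem {c : List ℤ} (h : IsEta c) (h0 : (0 : ℤ) ∈ c) : c = [0, 0] :=
  h.eq_zeros_or_pos.resolve_right fun hp => absurd (hp 0 h0) (by norm_num)

theorem eq_zeros_or_three_le_length {c : List ℤ} (h : IsEta c) : c = [0, 0] ∨ 3 ≤ c.length := by
  induction h with
  | base => exact .inl rfl
  | rotate _ ih => exact ih.imp (by rintro rfl; rfl) (by simp)
  | reverse _ ih => exact ih.imp (by rintro rfl; rfl) (by simp)
  | expand _ _ => simp

/-- An expansion may be performed between any two neighbouring entries. -/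
theorem expand_append {p t : List ℤ} {a b : ℤ} (h : IsEta (p ++ a :: b :: t)) :
    IsEta (p ++ (a + 1) :: 1 :: (b + 1) :: t) :=
  append_comm (u := (a + 1) :: 1 :: (b + 1) :: t) (expand (t := t ++ p) h.append_comm)

/-- An expansion may be performed between the last and the first entry. -/
theorem expand_ends {t : List ℤ} {a b : ℤ} (h : IsEta (b :: t ++ [a])) :
    IsEta ((b + 1) :: t ++ [a + 1, 1]) :=
  append_comm (u := [a + 1, 1]) (expand (append_comm (u := b :: t) h))

/-- Expansions can be undone: an entry `1` of an η-sequence of length at least three may be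
deleted while its two neighbours decrease by one. -/
theorem reduce_of_isRotated {c : List ℤ} (h : IsEta c) :
    ∀ {a b : ℤ} {t : List ℤ}, c ~r (a :: 1 :: b :: t) → IsEta ((a - 1) :: (b - 1) :: t) := by
  induction h with
  | base =>
    intro a b t h
    simpa using h.perm.length_eq
  | rotate _ ih =>
    intro a b t h
    exact ih ((List.IsRotated.forall _ 1).symm.trans h)
  | reverse _ ih =>
    intro a b t h
    have h' := ih (a := b) (b := a) (t := t.reverse) <| by
      have := h.reverse
      simp only [List.reverse_reverse, List.reverse_cons, List.append_assoc] at this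
      exact this.trans List.isRotated_append
    exact append_comm (u := t) (v := [a - 1, b - 1]) (by simpa using h'.reverse)
  | @expand a₀ b₀ t₀ hc ih =>
    intro a b t hrot
    obtain ⟨n, hn, h⟩ := List.isRotated_iff_mod.1 hrot
    clear hrot
    rw [List.rotate_eq_drop_append_take hn] at h
    have adj (ha : a₀ = 0 ∨ b₀ = 0) : a₀ = 0 ∧ b₀ = 0 ∧ t₀ = [] := by
      have := hc.eq_zeros_of_zero_mem (by rcases ha with rfl | rfl <;> simp)
      simpa using this
    match n with
    | 0 =>
      simp only [List.drop_zero, List.take_zero, List.append_nil, List.cons.injEq, true_and] at h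
      obtain ⟨rfl, rfl, rfl⟩ := h
      simpa using hc
    | 1 =>
      simp only [List.drop_succ_cons, List.drop_zero, List.take_succ_cons, List.take_zero,
        List.cons_append, List.cons.injEq] at h
      obtain ⟨rfl, hb, h⟩ := h
      obtain ⟨rfl, rfl, rfl⟩ := adj (.inr (by lia))
      simp only [List.nil_append, List.cons.injEq] at h
      obtain ⟨rfl, rfl⟩ := h
      exact base
    | 2 =>
      simp only [List.drop_succ_cons, List.drop_zero, List.take_succ_cons, List.take_zero,
        List.cons_append, List.cons.injEq] at h
      obtain ⟨rfl, h⟩ := h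
      match t₀, h with
      | [], h =>
        simp only [List.nil_append, List.cons.injEq] at h
        obtain ⟨ha, rfl, rfl⟩ := h
        obtain ⟨rfl, rfl, -⟩ := adj (.inl (by lia))
        exact base
      | [x], h =>
        simp only [List.cons_append, List.nil_append, List.cons.injEq] at h
        obtain ⟨rfl, rfl, rfl⟩ := h
        simpa using append_comm (u := [1]) hc.reverse
      | x :: y :: t₁, h =>
        simp only [List.cons_append, List.cons.injEq] at h
        obtain ⟨rfl, rfl, rfl⟩ := h
        have := expand_ends (t := (y - 1) :: t₁) (ih (a := b₀) (b := y) (t := t₁ ++ [a₀])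
          (List.isRotated_append (l := [a₀])))
        simpa using this
    | n + 3 =>
      simp only [List.drop_succ_cons, List.take_succ_cons] at h
      obtain ⟨t₁, t₂, h₁, h₂, rfl⟩ :
          ∃ t₁ t₂, t₁ = t₀.take n ∧ t₂ = t₀.drop n ∧ t₀ = t₁ ++ t₂ :=
        ⟨_, _, rfl, rfl, (List.take_append_drop n t₀).symm⟩
      rw [← h₁, ← h₂] at h
      match t₂, h with
      | [], h =>
        simp only [List.nil_append, List.cons.injEq, true_and] at h
        obtain ⟨rfl, rfl, rfl⟩ := h
        simpa using hc
      | [x], h =>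
        simp only [List.cons_append, List.nil_append, List.cons.injEq] at h
        have := adj (.inl (by lia))
        simp at this
      | [x, y], h =>
        simp only [List.cons_append, List.nil_append, List.cons.injEq] at h
        obtain ⟨rfl, rfl, rfl, rfl⟩ := h
        have := expand_append (p := [x - 1]) (ih (a := x) (b := a₀) (t := b₀ :: t₁)
          (List.isRotated_append (l := a₀ :: b₀ :: t₁)))
        simpa using this
      | x :: y :: z :: t₃, h =>
        simp only [List.cons_append, List.cons.injEq] at h
        obtain ⟨rfl, rfl, rfl, rfl⟩ := h
        have := ih (a := x) (b := z) (t := t₃ ++ a₀ :: b₀ :: t₁)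
          (by simpa using List.isRotated_append (l := a₀ :: b₀ :: t₁) (l' := x :: 1 :: z :: t₃))
        exact expand_append (p := (x - 1) :: (z - 1) :: t₃) this

theorem reduce {a b : ℤ} {t : List ℤ} (h : IsEta ((a + 1) :: 1 :: (b + 1) :: t)) :
    IsEta (a :: b :: t) := by
  simpa using h.reduce_of_isRotated (.refl _)

end IsEta

/-- The inverse of `psiMap`, sending `(c₁, …, cₙ)` to `(c₁ + 2, 1, …, cₙ + 2, 1)`. -/
def insertOnes (c : List ℤ) : List ℤ := c.flatMap fun x => [x + 2, 1]

@[simp] theorem insertOnes_nil : insertOnes [] = [] := rfl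

@[simp] theorem insertOnes_cons (x : ℤ) (c : List ℤ) :
    insertOnes (x :: c) = (x + 2) :: 1 :: insertOnes c := rfl

@[simp] theorem insertOnes_append (c d : List ℤ) :
    insertOnes (c ++ d) = insertOnes c ++ insertOnes d := List.flatMap_append

theorem insertOnes_reverse (c : List ℤ) :
    1 :: insertOnes c.reverse = (insertOnes c).reverse ++ [1] := by
  induction c with
  | nil => rfl
  | cons x c ih =>
    rw [List.reverse_cons, insertOnes_append, ← List.cons_append, ih]
    simp

theorem psiMap_insertOnes (c : List ℤ) : psiMap (insertOnes c) = c := by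
  induction c with
  | nil => rfl
  | cons x c ih => simp [psiMap, ih]

theorem even_length_insertOnes (c : List ℤ) : Even (insertOnes c).length := by
  induction c with
  | nil => simp
  | cons x c ih => simpa [Nat.even_add_one] using ih

theorem entryOf_insertOnes (c : List ℤ) :
    ∀ i ∈ Finset.Icc 1 (insertOnes c).length, Even i → entryOf (insertOnes c) i = 1 := by
  induction c with
  | nil => simp
  | cons x c ih =>
    intro i hi he
    match i with
    | 0 => simp at hi
    | 1 => simp at he
    | 2 => rfl
    | i + 3 =>
      have := ih (i + 1) (by simpa using hi) (by simpa [Nat.even_add_one] using he)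
      simpa [entryOf] using this

theorem insertOnes_psiMap : ∀ {c : List ℤ}, Even c.length →
    (∀ i ∈ Finset.Icc 1 c.length, Even i → entryOf c i = 1) → insertOnes (psiMap c) = c
  | [], _, _ => rfl
  | [_], he, _ => by simp at he
  | a :: b :: t, he, h => by
    have hb : b = 1 := h 2 (by simp) even_two
    have ht : insertOnes (psiMap t) = t :=
      insertOnes_psiMap (by simpa [Nat.even_add_one] using he) fun i hi hie => by
        obtain ⟨i, rfl⟩ : ∃ j, i = j + 1 := ⟨i - 1, by simp at hi; lia⟩
        have := h (i + 3) (by simpa using hi) (by simpa [Nat.even_add_one] using hie)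
        simpa [entryOf] using this
    simp [psiMap, ht, hb]

theorem isEta_insertOnes {c : List ℤ} (h : IsEta c) : IsEta (insertOnes c) := by
  induction h with
  | base => exact IsEta.expand_ends (t := [1]) (IsEta.expand IsEta.base)
  | @rotate c _ ih =>
    cases c with
    | nil => exact ih
    | cons x c => simpa using IsEta.append_comm (u := [x + 2, 1]) (v := insertOnes c) ih
  | @reverse c _ ih =>
    have hc := insertOnes_reverse c
    replace ih := ih.reverse
    cases hr : (insertOnes c).reverse with
    | nil => simpa [hr] using ih.two_le_length
    | cons y r =>
      rw [hr] at hc ih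
      obtain ⟨rfl, h⟩ := List.cons.inj hc.symm
      rw [← h]
      exact IsEta.append_comm (u := [1]) ih
  | @expand a b t _ ih =>
    have := IsEta.expand_append (p := [a + 3, 1]) (a := 2) (b := b + 2) (t := 1 :: insertOnes t)
      (by simpa [add_assoc] using IsEta.expand (b := 1) (t := insertOnes (b :: t)) ih)
    simpa [add_right_comm, add_assoc] using this

/-- Deleting the inserted ones one after the other, starting from a sequence in which the first
one has already been deleted. -/
theorem isEta_of_insertOnes_append {s : List ℤ} {x z : ℤ} {p : List ℤ}
    (h : IsEta ((x + 1) :: 1 :: (insertOnes s ++ (z + 1) :: p))) :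
    IsEta (x :: (s ++ z :: p)) := by
  induction s generalizing x p with
  | nil => exact h.reduce
  | cons y s ih =>
    have h' : IsEta (x :: (y + 1) :: 1 :: (insertOnes s ++ (z + 1) :: p)) :=
      IsEta.reduce (b := y + 1) (by simpa [add_assoc] using h)
    have := ih (x := y) (p := p ++ [x]) (by simpa using IsEta.append_comm (u := [x]) h')
    simpa using IsEta.append_comm (u := y :: (s ++ z :: p)) (v := [x]) (by simpa using this)

theorem isEta_of_insertOnes {c : List ℤ} (h : IsEta (insertOnes c)) : IsEta c := by
  match c, h with
  | [], h => simpa using h.two_le_length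
  | [x], h =>
    simpa using h.eq_zeros_or_three_le_length
  | x :: y :: s, h =>
    have h' : IsEta ((x + 1) :: (y + 1) :: 1 :: insertOnes s) :=
      IsEta.reduce (a := x + 1) (b := y + 1) (by simpa [add_assoc] using h)
    exact IsEta.append_comm (u := y :: s) (v := [x])
      (isEta_of_insertOnes_append (IsEta.append_comm (u := [x + 1]) h'))

theorem psi_bijOn :
    Set.BijOn psiMap
      {c : List ℤ | IsEta c ∧ Even c.length ∧
        ∀ i ∈ Finset.Icc 1 c.length, Even i → entryOf c i = 1}
      {c : List ℤ | IsEta c} := by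
  refine ⟨?_, ?_, ?_⟩
  · rintro c ⟨hc, he, h1⟩
    exact isEta_of_insertOnes ((insertOnes_psiMap he h1).symm ▸ hc)
  · rintro c ⟨-, he, h1⟩ d ⟨-, he', h1'⟩ h
    rw [← insertOnes_psiMap he h1, h, insertOnes_psiMap he' h1']
  · intro c hc
    exact ⟨insertOnes c, ⟨isEta_insertOnes hc, even_length_insertOnes c, entryOf_insertOnes c⟩,
      psiMap_insertOnes c⟩
end

section
/- Every η-sequence c = (c₁,…,cₙ) ∈ 𝒜⁺ with c ≠ (0,0) has an ear, i.e., there exists i ∈ {1,…,n} with c_i = 1. -/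
open Matrix Finset

/-- Every η-sequence is the trivial one or contains the entry `1`. -/
theorem IsEta.eq_zero_zero_or_one_mem {c : List ℤ} (h : IsEta c) : c = [0, 0] ∨ 1 ∈ c := by
  induction h with
  | base => exact Or.inl rfl
  | rotate _ ih =>
    rcases ih with rfl | ih
    · exact Or.inl rfl
    · exact Or.inr (List.mem_rotate.mpr ih)
  | reverse _ ih =>
    rcases ih with rfl | ih
    · exact Or.inl rfl
    · exact Or.inr (List.mem_reverse.mpr ih)
  | expand _ _ => exact Or.inr (by simp)

theorem exists_ear (c : List ℤ) (h : IsEta c) (hne : c ≠ [0, 0]) :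
    ∃ i ∈ Finset.Icc 1 c.length, entryOf c i = 1 := by
  obtain ⟨k, hk, hck⟩ := List.getElem_of_mem (h.eq_zero_zero_or_one_mem.resolve_left hne)
  refine ⟨k + 1, Finset.mem_Icc.mpr ⟨by omega, by omega⟩, ?_⟩
  simp [entryOf, hk, hck]
end

section
/- Let c = (c₁,…,cₙ) ∈ 𝒜⁺ and suppose there exists i ∈ {1,…,n} with c_i = 1 and c_{i⊕1} = 1, where i⊕1 denotes i+1 with n⊕1 := 1 (i.e., c has two cyclically neighboring entries equal to 1). Then c = (1,1,1). -/
open Matrix Finset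

/-- Both entries are positive and they are not both equal to `1`. -/
def PosNotBothOne (x y : ℤ) : Prop := 1 ≤ x ∧ 1 ≤ y ∧ 3 ≤ x + y

lemma posNotBothOne_chain_expand {a b : ℤ} {t : List ℤ}
    (h : Cycle.Chain PosNotBothOne ((a :: b :: t : List ℤ) : Cycle ℤ)) :
    Cycle.Chain PosNotBothOne (((a + 1) :: 1 :: (b + 1) :: t : List ℤ) : Cycle ℤ) := by
  simp only [Cycle.chain_coe_cons, List.cons_append, List.isChain_cons_cons] at h ⊢
  obtain ⟨⟨ha, hb, -⟩, hbt⟩ := h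
  refine ⟨⟨by omega, le_rfl, by omega⟩, ⟨le_rfl, by omega, by omega⟩, ?_⟩
  rcases List.eq_nil_or_concat' t with rfl | ⟨s, z, rfl⟩
  · simp only [List.nil_append, List.isChain_cons_cons, List.isChain_singleton, and_true]
    exact ⟨by omega, by omega, by omega⟩
  · have hz : List.IsChain PosNotBothOne ((s ++ [z]) ++ [a + 1]) := by
      have h' := (List.isChain_cons.1 hbt).2
      rw [List.append_assoc, List.singleton_append, List.isChain_append_cons_cons] at h' ⊢
      obtain ⟨hs, ⟨hz1, ha1, hza⟩, -⟩ := h'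
      exact ⟨hs, ⟨hz1, by omega, by omega⟩, List.isChain_singleton _⟩
    refine List.isChain_cons.2 ⟨fun y hy => ?_, hz⟩
    have hy' : y ∈ ((s ++ [z]) ++ [a]).head? := by
      cases s <;> simpa using hy
    obtain ⟨h1, h2, h3⟩ := (List.isChain_cons.1 hbt).1 y hy'
    exact ⟨by omega, h2, by omega⟩

lemma posNotBothOne_chain_reverse {c : List ℤ}
    (h : Cycle.Chain PosNotBothOne (c : Cycle ℤ)) :
    Cycle.Chain PosNotBothOne (c.reverse : Cycle ℤ) := by
  have hsymm : (fun x y => PosNotBothOne y x) = PosNotBothOne := by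
    funext x y
    exact propext ⟨fun ⟨h1, h2, h3⟩ => ⟨h2, h1, by omega⟩,
      fun ⟨h1, h2, h3⟩ => ⟨h2, h1, by omega⟩⟩
  cases c with
  | nil => exact h
  | cons a l =>
    have hrot : ((a :: l).reverse : Cycle ℤ) = ((a :: l.reverse : List ℤ) : Cycle ℤ) := by
      rw [Cycle.coe_eq_coe, List.reverse_cons]
      exact List.isRotated_append
    rw [hrot, Cycle.chain_coe_cons]
    rw [Cycle.chain_coe_cons, ← hsymm, ← List.isChain_reverse] at h
    simpa using h

lemma IsEta.eq_or_posNotBothOne_chain {c : List ℤ} (h : IsEta c) :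
    c = [0, 0] ∨ c = [1, 1, 1] ∨ Cycle.Chain PosNotBothOne (c : Cycle ℤ) := by
  induction h with
  | base => exact Or.inl rfl
  | @rotate c _ ih =>
    rcases ih with rfl | rfl | ih
    · exact Or.inl rfl
    · exact Or.inr (Or.inl rfl)
    · have : ((c.rotate 1 : List ℤ) : Cycle ℤ) = (c : Cycle ℤ) :=
        Cycle.coe_eq_coe.2 (List.IsRotated.symm ⟨1, rfl⟩)
      exact Or.inr (Or.inr (this ▸ ih))
  | reverse _ ih =>
    rcases ih with rfl | rfl | ih
    · exact Or.inl rfl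
    · exact Or.inr (Or.inl rfl)
    · exact Or.inr (Or.inr (posNotBothOne_chain_reverse ih))
  | @expand a b t _ ih =>
    rcases ih with ih | ih | ih
    · obtain ⟨rfl, rfl, rfl⟩ : a = 0 ∧ b = 0 ∧ t = [] := by simpa using ih
      exact Or.inr (Or.inl rfl)
    · obtain ⟨rfl, rfl, rfl⟩ : a = 1 ∧ b = 1 ∧ t = [1] := by simpa using ih
      refine Or.inr (Or.inr ?_)
      simp [PosNotBothOne]
    · exact Or.inr (Or.inr (posNotBothOne_chain_expand ih))

lemma entryOf_chain {r : ℤ → ℤ → Prop} {c : List ℤ} (h : Cycle.Chain r (c : Cycle ℤ))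
    {i : ℕ} (hi : i ∈ Finset.Icc 1 c.length) :
    r (entryOf c i) (entryOf c (addIdx c.length i 1)) := by
  obtain ⟨hi1, hin⟩ := Finset.mem_Icc.1 hi
  cases c with
  | nil => simp at hin; omega
  | cons a l =>
    obtain ⟨j, rfl⟩ : ∃ j, i = j + 1 := ⟨i - 1, by omega⟩
    rw [Cycle.chain_coe_cons, List.isChain_iff_getElem] at h
    simp only [List.length_cons] at hin
    have hj := h j (by simp; omega)
    simp only [← List.cons_append] at hj
    rw [List.getElem_append_left (by simp; omega)] at hj
    unfold entryOf addIdx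
    split_ifs with hlt
    · simp only [List.length_cons] at hlt
      rw [List.getElem_append_left (by simp; omega)] at hj
      simpa [List.getD_eq_getElem?_getD, show j < l.length + 1 by omega,
        show j < l.length by omega] using hj
    · simp only [List.length_cons] at hlt
      obtain rfl : j = l.length := by omega
      simpa [List.getD_eq_getElem?_getD] using hj

theorem neighboring_ones (c : List ℤ) (h : IsEta c)
    (i : ℕ) (hi : i ∈ Finset.Icc 1 c.length)
    (h1 : entryOf c i = 1) (h2 : entryOf c (addIdx c.length i 1) = 1) :
    c = [1, 1, 1] := by
  rcases h.eq_or_posNotBothOne_chain with rfl | rfl | hc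
  · have : entryOf [0, 0] i = 0 := by
      obtain ⟨hi1, hi2⟩ := Finset.mem_Icc.1 hi
      simp only [List.length_cons, List.length_nil] at hi2
      interval_cases i <;> rfl
    omega
  · rfl
  · have := entryOf_chain hc hi
    rw [h1, h2] at this
    exact absurd this.2.2 (by norm_num)
end

section
/- Let c = (c₁,…,cₙ) ∈ 𝒜⁺ and suppose there exists i ∈ {1,…,n} with c_i = 1, c_{i⊕1} = 2, and c_{i⊕2} = 1, where ⊕ denotes addition of indices modulo n with values in {1,…,n} (i.e., c contains (1,2,1) as a cyclic block of consecutive entries). Then n = 4 and c is a cyclic rotation of (1,2,1,2). -/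
open Matrix Finset

theorem List.isRotated_reverse_cons_cons {α : Type*} {c t : List α} {x y : α}
    (h : c.reverse ~r x :: y :: t) : c ~r y :: x :: t.reverse := by
  have h' : c ~r t.reverse ++ [y, x] := by simpa using h.reverse
  exact h'.trans List.isRotated_append

/-- A rotation of `p :: q :: r :: t` starts inside `t`, at `p`, at `q`, or at `r`. -/
theorem List.isRotated_cons_cons_cons_cases {α : Type*} {p q r : α} {t d : List α}
    (h : p :: q :: r :: t ~r d) :
    (∃ x y, t = x ++ y ∧ d = y ++ p :: q :: r :: x) ∨ d = q :: r :: t ++ [p] ∨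
      d = r :: t ++ [p, q] := by
  obtain ⟨k, hk, rfl⟩ := List.isRotated_iff_mod.mp h
  rw [List.rotate_eq_drop_append_take hk]
  match k with
  | 0 => exact .inl ⟨t, [], by simp⟩
  | 1 => simp
  | 2 => simp
  | k + 3 => exact .inl ⟨t.take k, t.drop k, by simp⟩

theorem IsEta.eq_or_pos {c : List ℤ} (h : IsEta c) :
    c = [0, 0] ∨ 3 ≤ c.length ∧ ∀ x ∈ c, 1 ≤ x := by
  induction h with
  | base => simp
  | rotate _ ih =>
    rcases ih with rfl | ih
    · simp
    · exact .inr (by simpa using ih)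
  | reverse _ ih =>
    rcases ih with rfl | ih
    · simp
    · exact .inr (by simpa using ih)
  | expand _ ih =>
    right
    simp only [List.cons.injEq, List.length_cons, List.forall_mem_cons] at ih ⊢
    rcases ih with ⟨rfl, rfl, rfl⟩ | ⟨-, ha, hb, ht⟩
    · simp
    · exact ⟨by lia, by lia, le_rfl, by lia, ht⟩

theorem IsEta.cons_cons_cases {a b : ℤ} {t : List ℤ} (h : IsEta (a :: b :: t)) :
    a = 0 ∧ b = 0 ∧ t = [] ∨ t ≠ [] ∧ 1 ≤ a ∧ 1 ≤ b := by
  rcases h.eq_or_pos with h | ⟨hlen, h⟩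
  · exact .inl (by simpa using h)
  · refine .inr ⟨?_, h a (by simp), h b (by simp)⟩
    rintro rfl
    simp at hlen

theorem IsEta.eq_of_isRotated_one_one {c : List ℤ} (h : IsEta c) {t : List ℤ}
    (ht : c ~r 1 :: 1 :: t) : t = [1] := by
  induction h generalizing t with
  | base =>
    have := ht.mem_iff (a := 1)
    simp at this
  | rotate _ ih => exact ih (List.IsRotated.trans ⟨1, rfl⟩ ht)
  | reverse _ ih => simpa using ih (List.isRotated_reverse_cons_cons ht)
  | @expand a b s h ih =>
    have hp := h.cons_cons_cases
    rcases List.isRotated_cons_cons_cons_cases ht with ⟨x, y, rfl, hd⟩ | hd | hd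
    · match y with
      | [] =>
        simp only [List.nil_append, List.append_nil, List.cons.injEq] at hd hp
        obtain ⟨ha, -, rfl⟩ := hd
        obtain ⟨-, rfl, rfl⟩ := hp.resolve_right (by lia)
        rfl
      | [p] =>
        simp at hd hp
        lia
      | p :: q :: y =>
        simp only [List.cons_append, List.cons.injEq] at hd
        obtain ⟨rfl, rfl, -⟩ := hd
        have := congrArg List.length (ih (t := y ++ a :: b :: x)
          (List.isRotated_append (l := a :: b :: x) (l' := 1 :: 1 :: y)))
        simp at this
        lia
    · simp only [List.cons_append, List.cons.injEq] at hd
      obtain ⟨-, hb, rfl⟩ := hd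
      obtain ⟨rfl, -, rfl⟩ := hp.resolve_right (by lia)
      simp
    · simp only [List.cons_append, List.cons.injEq] at hd
      obtain ⟨hb, hd⟩ := hd
      obtain ⟨rfl, rfl, rfl⟩ := hp.resolve_right (by lia)
      simpa using hd

theorem IsEta.eq_of_isRotated_one_two_one {c : List ℤ} (h : IsEta c) {t : List ℤ}
    (ht : c ~r 1 :: 2 :: 1 :: t) : t = [2] := by
  induction h generalizing t with
  | base =>
    have := ht.mem_iff (a := 1)
    simp at this
  | rotate _ ih => exact ih (List.IsRotated.trans ⟨1, rfl⟩ ht)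
  | @reverse c _ ih =>
    have h' : c ~r t.reverse ++ [1, 2, 1] := by simpa using ht.reverse
    simpa using ih (h'.trans List.isRotated_append)
  | @expand a b s h ih =>
    have hp := h.cons_cons_cases
    rcases List.isRotated_cons_cons_cons_cases ht with ⟨x, y, rfl, hd⟩ | hd | hd
    · match y with
      | [] => simp at hd
      | [p] =>
        simp only [List.cons_append, List.nil_append, List.cons.injEq] at hd
        obtain ⟨rfl, ha, -, rfl⟩ := hd
        obtain rfl : a = 1 := by lia
        have := h.eq_of_isRotated_one_one (t := b :: x)
          (List.isRotated_append (l := 1 :: b :: x) (l' := [1]))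
        simp only [List.cons.injEq] at this
        simp [this]
      | [p, q] =>
        simp at hd hp
        lia
      | p :: q :: r :: y =>
        simp only [List.cons_append, List.cons.injEq] at hd
        obtain ⟨rfl, rfl, rfl, -⟩ := hd
        have := congrArg List.length (ih (t := y ++ a :: b :: x)
          (List.isRotated_append (l := a :: b :: x) (l' := 1 :: 2 :: 1 :: y)))
        simp at this
        lia
    · match s with
      | [] => simp at hd hp; lia
      | p :: s =>
        simp only [List.cons_append, List.cons.injEq] at hd
        obtain ⟨-, hb, rfl, rfl⟩ := hd
        obtain rfl : b = 1 := by lia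
        have := h.eq_of_isRotated_one_one (t := s ++ [a])
          (List.isRotated_append (l := [a]) (l' := 1 :: 1 :: s))
        rw [List.append_eq_singleton_iff] at this
        rcases this with ⟨rfl, ha⟩ | ⟨-, ha⟩
        · simp_all
        · simp at ha
    · simp only [List.cons_append, List.cons.injEq] at hd
      obtain ⟨hb, hd⟩ := hd
      obtain ⟨rfl, rfl, rfl⟩ := hp.resolve_right (by lia)
      simp at hd

theorem getElem?_rotate_eq_entryOf {c : List ℤ} {i k : ℕ} (hi : i ∈ Finset.Icc 1 c.length)
    (hk : k < c.length) : (c.rotate (i - 1))[k]? = some (entryOf c (addIdx c.length i k)) := by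
  obtain ⟨h1, h2⟩ := Finset.mem_Icc.mp hi
  have hmod : (k + (i - 1)) % c.length = addIdx c.length i k - 1 := by
    unfold addIdx
    split_ifs
    · rw [Nat.mod_eq_of_lt (by lia)]
      lia
    · rw [Nat.mod_eq_sub_mod (by lia), Nat.mod_eq_of_lt (by lia)]
      lia
  have hlt : addIdx c.length i k - 1 < c.length := hmod ▸ Nat.mod_lt _ (by lia)
  rw [List.getElem?_rotate hk, hmod, entryOf, List.getD_eq_getElem _ _ hlt,
    List.getElem?_eq_getElem hlt]

theorem block_one_two_one (c : List ℤ) (h : IsEta c)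
    (i : ℕ) (hi : i ∈ Finset.Icc 1 c.length)
    (h1 : entryOf c i = 1) (h2 : entryOf c (addIdx c.length i 1) = 2)
    (h3 : entryOf c (addIdx c.length i 2) = 1) :
    c.length = 4 ∧ ∃ k, c = ([1, 2, 1, 2] : List ℤ).rotate k := by
  rcases h.eq_or_pos with rfl | ⟨hlen, -⟩
  · have : i = 1 ∨ i = 2 := by simp at hi; lia
    rcases this with rfl | rfl <;> simp [entryOf] at h1
  have e0 := getElem?_rotate_eq_entryOf hi (k := 0) (by lia)
  have e1 := getElem?_rotate_eq_entryOf hi (k := 1) (by lia)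
  have e2 := getElem?_rotate_eq_entryOf hi (k := 2) (by lia)
  rw [addIdx, if_pos (by simpa using (Finset.mem_Icc.mp hi).2), add_zero, h1] at e0
  rw [h2] at e1
  rw [h3] at e2
  have hr : c ~r c.rotate (i - 1) := ⟨_, rfl⟩
  match hd : c.rotate (i - 1) with
  | [] | [_] | [_, _] => simp [hd] at e2
  | p :: q :: r :: t =>
    rw [hd] at e0 e1 e2 hr
    simp only [List.getElem?_cons_zero, List.getElem?_cons_succ, Option.some.injEq] at e0 e1 e2
    subst e0 e1 e2
    obtain rfl := h.eq_of_isRotated_one_two_one hr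
    obtain ⟨k, hk⟩ := hr.symm
    exact ⟨hr.perm.length_eq, k, hk.symm⟩
end
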